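/- arXiv:1812.08969 — 6 statements merged into one kernel-verified Lean document; each statement's English description precedes it below -/
import Mathlib

section
/- Let X^k = {x_i^k} (k ≥ k₀ > ‖F‖_∞/ε) be classical solutions of the penalized system ẋ_i^k(t) = F_i(t, X^k(t)) − k(d∇d)(x_i^k(t)) with common initial datum X° ∈ G, and suppose X^k → X uniformly on [0,T] with X(t) ∈ G for all t. Fix an index i. Then for every t₀ ∈ (0,T] with x_i(t₀) ∈ ∂Ω, one has ν(x_i(t₀)) · F_i(t₀, X(t₀)) ≥ 0. -/
open Set MeasureTheory Filter
open scoped RealInnerProductSpace Topology NNReal ContDiff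

noncomputable section

/-- Points of `ℝ^m`. -/
abbrev Pt (m : ℕ) := EuclideanSpace ℝ (Fin m)

/-- Configurations of `n` particles in `ℝ^m`, equipped with the sup-norm
`‖X‖ = max_i |x_i|`. -/
abbrev Conf (m n : ℕ) := Fin n → Pt m

variable {m n : ℕ}

open Classical in
/-- Signed distance function with respect to the boundary of `Ω`:
nonpositive on `cl Ω`, positive outside. -/
def sgnDist (Ω : Set (Pt m)) (x : Pt m) : ℝ :=
  if x ∈ closure Ω then -Metric.infDist x (frontier Ω) else Metric.infDist x (frontier Ω)

/-- `Ω ⊆ ℝ^m` is a nonempty bounded open domain with `C²` boundary and outward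
unit normal field `ν`: the signed distance function is `C²` near each boundary
point, and its gradient on the boundary is the outward unit normal `ν`. -/
structure IsC2Domain (Ω : Set (Pt m)) (ν : Pt m → Pt m) : Prop where
  isOpen : IsOpen Ω
  nonempty : Ω.Nonempty
  bounded : Bornology.IsBounded Ω
  smoothBoundary : ∀ x ∈ frontier Ω, ContDiffAt ℝ 2 (sgnDist Ω) x
  grad_eq_normal : ∀ x ∈ frontier Ω, gradient (sgnDist Ω) x = ν x
  normal_unit : ∀ x ∈ frontier Ω, ‖ν x‖ = 1

open Classical in
/-- The one-sided projection `P(x,f)`: if `x ∈ ∂Ω` and `f · ν(x) > 0` then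
`P(x,f) = f - (f·ν(x)) ν(x)`, otherwise `P(x,f) = f`. -/
def oneProj (Ω : Set (Pt m)) (ν : Pt m → Pt m) (x f : Pt m) : Pt m :=
  if x ∈ frontier Ω ∧ 0 < ⟪f, ν x⟫ then f - ⟪f, ν x⟫ • ν x else f

/-- The set `G = (cl Ω)^n` of admissible configurations. -/
def Gset (Ω : Set (Pt m)) (n : ℕ) : Set (Conf m n) := {X | ∀ i, X i ∈ closure Ω}

/-- Mild solution of the confined particle system
`ẋ_i = H_i(t, X) = P(x_i, F_i(t,X))` on `[0,T]` with initial condition `X0`: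
each `x_i` is continuous, stays in `cl Ω` and satisfies
`x_i(t) = x_i(0) + ∫₀ᵗ H_i(s, X(s)) ds`. -/
def IsMildSol (Ω : Set (Pt m)) (ν : Pt m → Pt m) (F : Fin n → ℝ → Conf m n → Pt m)
    (T : ℝ) (X0 : Conf m n) (X : ℝ → Conf m n) : Prop :=
  (∀ i, ContinuousOn (fun t => X t i) (Icc 0 T)) ∧
  (∀ t ∈ Icc (0:ℝ) T, ∀ i, X t i ∈ closure Ω) ∧
  (∀ t ∈ Icc (0:ℝ) T, ∀ i,
    X t i = X0 i + ∫ s in (0:ℝ)..t, oneProj Ω ν (X s i) (F i s (X s)))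

/-- The distance function `d(x) = dist(x, cl Ω)`. -/
def distCl (Ω : Set (Pt m)) (x : Pt m) : ℝ := Metric.infDist x (closure Ω)

open Classical in
/-- The function `d ∇d`, extended by `0` on `cl Ω`. -/
def dGradd (Ω : Set (Pt m)) (x : Pt m) : Pt m :=
  if x ∈ closure Ω then 0 else distCl Ω x • gradient (distCl Ω) x

/-- Classical solution of the penalized system
`ẋ_i(t) = F_i(t, X(t)) - k (d∇d)(x_i(t))` on `[0,T]`. -/
def IsPenalSol (Ω : Set (Pt m)) (F : Fin n → ℝ → Conf m n → Pt m)
    (T k : ℝ) (X0 : Conf m n) (X : ℝ → Conf m n) : Prop :=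
  X 0 = X0 ∧
  ∀ i, ∀ t ∈ Icc (0:ℝ) T,
    HasDerivWithinAt (fun s => X s i) (F i t (X t) - k • dGradd Ω (X t i)) (Icc 0 T) t

/-- Admissible configurations with pairwise distinct particle positions. -/
def Gstar (Ω : Set (Pt m)) (n : ℕ) : Set (Conf m n) :=
  {X | (∀ i, X i ∈ closure Ω) ∧ ∀ i j, i ≠ j → X i ≠ X j}

/-- The particle interaction energy
`E(X) = (1/(n(n-1))) Σ_{j<i} V(x_i - x_j) + (1/n) Σ_i W(x_i)`. -/
def energy (V W : Pt m → ℝ) (X : Conf m n) : ℝ :=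
  (1 / ((n : ℝ) * ((n : ℝ) - 1))) *
      ∑ i : Fin n, ∑ j ∈ Finset.filter (fun j => j < i) Finset.univ, V (X i - X j) +
    (1 / (n : ℝ)) * ∑ i : Fin n, W (X i)

/-- The gradient `∇_{x_i} E(X)` of the energy with respect to particle `i`. -/
def Egrad (V W : Pt m → ℝ) (i : Fin n) (X : Conf m n) : Pt m :=
  gradient (fun y => energy V W (Function.update X i y)) (X i)

theorem sgnDist_eq_distCl_aux {m : ℕ} (Ω : Set (Pt m)) (hne : Ω.Nonempty) (x : Pt m)
    (hx : x ∉ closure Ω) : sgnDist Ω x = distCl Ω x := by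
  unfold sgnDist distCl
  rw [if_neg hx]
  obtain ⟨y, hy, hxy⟩ := exists_mem_frontier_infDist_compl_eq_dist
    (s := (closure Ω)ᶜ) (x := x) hx (by
      intro h
      have : closure Ω = ∅ := by simpa using h
      exact (hne.mono subset_closure).ne_empty this)
  rw [compl_compl] at hxy
  rw [frontier_compl] at hy
  have hy' := frontier_closure_subset hy
  apply le_antisymm
  · rw [hxy]; exact Metric.infDist_le_dist_of_mem hy'
  · exact Metric.infDist_le_infDist_of_subset frontier_subset_closure ⟨y, hy'⟩

theorem fderiv_sgnDist_dGradd_nonneg {m : ℕ} (Ω : Set (Pt m)) (hne : Ω.Nonempty) (x : Pt m) :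
    0 ≤ fderiv ℝ (sgnDist Ω) x (dGradd Ω x) := by
  unfold dGradd
  split_ifs with hx
  · simp
  · have h : sgnDist Ω =ᶠ[𝓝 x] distCl Ω := by
      filter_upwards [isClosed_closure.isOpen_compl.mem_nhds hx] with y hy
      exact sgnDist_eq_distCl_aux Ω hne y hy
    rw [h.fderiv_eq, map_smul, smul_eq_mul]
    apply mul_nonneg Metric.infDist_nonneg
    have : fderiv ℝ (distCl Ω) x (gradient (distCl Ω) x)
        = ⟪gradient (distCl Ω) x, gradient (distCl Ω) x⟫ := by
      simp only [gradient, InnerProductSpace.toDual_symm_apply]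
    rw [this]
    exact real_inner_self_nonneg

/-- **Lemma (no inward force at limit boundary points).**
If the penalized solutions converge uniformly to `X` and `x_i(t₀) ∈ ∂Ω` for
some `t₀ ∈ (0,T]`, then `ν(x_i(t₀)) · F_i(t₀, X(t₀)) ≥ 0`. -/
theorem limit_boundary_force_nonneg {m n : ℕ} (Ω : Set (Pt m)) (ν : Pt m → Pt m)
    (hΩ : IsC2Domain Ω ν) (ε : ℝ) (hε : 0 < ε)
    (hd1 : ContDiffOn ℝ 2 (distCl Ω) (closure (Metric.thickening ε (frontier Ω)) \ Ω))
    (hd2 : ∀ x ∈ closure (Metric.thickening ε Ω) \ closure Ω,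
      ContDiffAt ℝ 2 (distCl Ω) x)
    (T : ℝ) (hT : 0 < T) (F : Fin n → ℝ → Conf m n → Pt m)
    (hFc : ∀ i, Continuous (Function.uncurry (F i)))
    (M : ℝ) (hM : ∀ i, ∀ t ∈ Icc (0:ℝ) T, ∀ X : Conf m n, ‖F i t X‖ ≤ M)
    (k₀ : ℕ) (hk₀ : M / ε < (k₀ : ℝ))
    (X0 : Conf m n) (hX0 : X0 ∈ Gset Ω n)
    (Xk : ℕ → ℝ → Conf m n)
    (hsol : ∀ k, k₀ ≤ k → IsPenalSol Ω F T (k : ℝ) X0 (Xk k))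
    (X : ℝ → Conf m n)
    (hconv : TendstoUniformlyOn (fun k t => Xk k t) X atTop (Icc 0 T))
    (hXG : ∀ t ∈ Icc (0:ℝ) T, X t ∈ Gset Ω n) (i : Fin n) :
    ∀ t₀ ∈ Ioc (0:ℝ) T, X t₀ i ∈ frontier Ω →
      0 ≤ ⟪ν (X t₀ i), F i t₀ (X t₀)⟫ := by
  intro t₀ ht₀ hfr
  by_contra hneg
  push Not at hneg
  set x₀ := X t₀ i with hx₀
  have hC2 := hΩ.smoothBoundary x₀ hfr
  have ht₀' : t₀ ∈ Icc (0:ℝ) T := ⟨ht₀.1.le, ht₀.2⟩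
  have hval : fderiv ℝ (sgnDist Ω) x₀ (F i t₀ (X t₀)) = ⟪ν x₀, F i t₀ (X t₀)⟫ := by
    rw [← hΩ.grad_eq_normal x₀ hfr]
    simp [gradient]
  obtain ⟨c, hc, hcv⟩ : ∃ c : ℝ, 0 < c ∧ ⟪ν x₀, F i t₀ (X t₀)⟫ < -c :=
    ⟨-⟪ν x₀, F i t₀ (X t₀)⟫ / 2, by linarith, by linarith⟩
  -- local estimate
  have hproj : Tendsto (fun p : ℝ × Conf m n => p.2 i) (𝓝 (t₀, X t₀)) (𝓝 x₀) := by
    have : Continuous (fun p : ℝ × Conf m n => p.2 i) := by fun_prop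
    exact this.tendsto (t₀, X t₀)
  have hfd : ContinuousAt (fderiv ℝ (sgnDist Ω)) x₀ :=
    (hC2.fderiv_right (m := 1) (by norm_num)).continuousAt
  have hdiff : ∀ᶠ y in 𝓝 x₀, DifferentiableAt ℝ (sgnDist Ω) y := by
    filter_upwards [hC2.eventually (by simp)] with y hy
    exact hy.differentiableAt (by simp)
  have hg : Tendsto (fun p : ℝ × Conf m n => fderiv ℝ (sgnDist Ω) (p.2 i) (F i p.1 p.2))
      (𝓝 (t₀, X t₀)) (𝓝 (fderiv ℝ (sgnDist Ω) x₀ (F i t₀ (X t₀)))) :=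
    isBoundedBilinearMap_apply.continuous.continuousAt.tendsto.comp
      ((hfd.tendsto.comp hproj).prodMk_nhds ((hFc i).tendsto (t₀, X t₀)))
  have hev : ∀ᶠ p : ℝ × Conf m n in 𝓝 (t₀, X t₀),
      fderiv ℝ (sgnDist Ω) (p.2 i) (F i p.1 p.2) < -c ∧
        DifferentiableAt ℝ (sgnDist Ω) (p.2 i) :=
    (hg.eventually_lt_const (by rw [hval]; exact hcv)).and (hproj.eventually hdiff)
  obtain ⟨r, hr, hball⟩ := Metric.eventually_nhds_iff.1 hev
  -- continuity of the limit
  have hXkc : ∀ k, k₀ ≤ k → ContinuousOn (Xk k) (Icc 0 T) := fun k hk =>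
    continuousOn_pi.2 fun j t ht => ((hsol k hk).2 j t ht).continuousWithinAt
  have hXc : ContinuousOn X (Icc 0 T) :=
    hconv.continuousOn ((eventually_ge_atTop k₀).mono hXkc).frequently
  obtain ⟨δ, hδ, hXδ⟩ := Metric.continuousOn_iff.1 hXc t₀ ht₀' (r / 2) (by linarith)
  set η := min (min δ r) t₀ / 2 with hη
  have hm : 0 < min (min δ r) t₀ := lt_min (lt_min hδ hr) ht₀.1
  have hη0 : 0 < η := by linarith
  have hηδ : η < δ := by
    have := (min_le_left (min δ r) t₀).trans (min_le_left δ r); linarith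
  have hηr : η < r := by
    have := (min_le_left (min δ r) t₀).trans (min_le_right δ r); linarith
  have hηt : η < t₀ := by
    have := min_le_right (min δ r) t₀; linarith
  set t₁ := t₀ - η with ht₁
  have hsub : Icc t₁ t₀ ⊆ Icc 0 T := Icc_subset_Icc (by linarith) ht₀.2
  have hnear : ∀ t ∈ Icc t₁ t₀, dist t t₀ ≤ η := by
    intro t ht
    rw [Real.dist_eq, abs_le]
    constructor <;> linarith [ht.1, ht.2]
  have ht₁m : t₁ ∈ Icc t₁ t₀ := ⟨le_rfl, by linarith⟩
  have ht₀m : t₀ ∈ Icc t₁ t₀ := ⟨by linarith, le_rfl⟩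
  have hXP : ∀ t ∈ Icc t₁ t₀, dist (X t) (X t₀) < r / 2 := fun t ht =>
    hXδ t (hsub ht) ((hnear t ht).trans_lt hηδ)
  have hcontX : ∀ t ∈ Icc t₁ t₀, ContinuousAt (sgnDist Ω) (X t i) := fun t ht =>
    (hball (y := (t, X t)) (by
      rw [Prod.dist_eq]
      exact max_lt ((hnear t ht).trans_lt hηr) ((hXP t ht).trans (by linarith)))).2.continuousAt
  have hlim : ∀ t ∈ Icc t₁ t₀,
      Tendsto (fun k => sgnDist Ω (Xk k t i)) atTop (𝓝 (sgnDist Ω (X t i))) := fun t ht =>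
    (hcontX t ht).tendsto.comp
      ((continuous_apply i).continuousAt.tendsto.comp (hconv.tendsto_at (hsub ht)))
  have hkey : ∀ᶠ k in atTop,
      sgnDist Ω (Xk k t₀ i) + c * t₀ ≤ sgnDist Ω (Xk k t₁ i) + c * t₁ := by
    filter_upwards [eventually_ge_atTop k₀,
      Metric.tendstoUniformlyOn_iff.1 hconv (r / 2) (by linarith)] with k hk hkr
    have hP : ∀ t ∈ Icc t₁ t₀,
        fderiv ℝ (sgnDist Ω) (Xk k t i) (F i t (Xk k t)) < -c ∧
          DifferentiableAt ℝ (sgnDist Ω) (Xk k t i) := by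
      intro t ht
      refine hball (y := (t, Xk k t)) ?_
      rw [Prod.dist_eq]
      refine max_lt ((hnear t ht).trans_lt hηr) ?_
      have h1 := hkr t (hsub ht)
      have h2 := hXP t ht
      have h3 := dist_triangle (Xk k t) (X t) (X t₀)
      rw [dist_comm] at h1
      change dist (Xk k t) (X t₀) < r
      linarith
    have hder : ∀ t ∈ Icc t₁ t₀, HasDerivWithinAt (fun t => sgnDist Ω (Xk k t i) + c * t)
        (fderiv ℝ (sgnDist Ω) (Xk k t i) (F i t (Xk k t) - (k:ℝ) • dGradd Ω (Xk k t i)) + c * 1)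
        (Icc t₁ t₀) t := by
      intro t ht
      have h1 := ((hsol k hk).2 i t (hsub ht)).mono hsub
      have h2 := (hP t ht).2.hasFDerivAt.comp_hasDerivWithinAt t h1
      exact h2.add ((hasDerivWithinAt_id t _).const_mul c)
    have hanti : AntitoneOn (fun t => sgnDist Ω (Xk k t i) + c * t) (Icc t₁ t₀) := by
      refine antitoneOn_of_hasDerivWithinAt_nonpos (convex_Icc _ _)
        (fun t ht => (hder t ht).continuousWithinAt)
        (fun t ht => (hder t (interior_subset ht)).mono interior_subset) ?_
      intro t ht
      have h1 := (hP t (interior_subset ht)).1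
      have h2 := fderiv_sgnDist_dGradd_nonneg Ω hΩ.nonempty (Xk k t i)
      rw [map_sub, map_smul, smul_eq_mul]
      have h3 := mul_nonneg (Nat.cast_nonneg (α := ℝ) k) h2
      linarith
    exact hanti ht₁m ht₀m (by linarith)
  have hle := le_of_tendsto_of_tendsto ((hlim t₀ ht₀m).add_const (c * t₀))
    ((hlim t₁ ht₁m).add_const (c * t₁)) hkey
  have h0 : sgnDist Ω (X t₀ i) = 0 := by
    unfold sgnDist
    rw [if_pos (hXG t₀ ht₀' i), Metric.infDist_zero_of_mem hfr, neg_zero]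
  have h1 : sgnDist Ω (X t₁ i) ≤ 0 := by
    unfold sgnDist
    rw [if_pos (hXG t₁ (hsub ht₁m) i)]
    exact neg_nonpos.2 Metric.infDist_nonneg
  have h2 : 0 < c * η := mul_pos hc hη0
  have h3 : c * t₁ = c * t₀ - c * η := by rw [ht₁]; ring
  linarith
end
end

section
/- Let X^k = {x_i^k} (k ≥ k₀ > ‖F‖_∞/ε) be classical solutions of the penalized system ẋ_i^k(t) = F_i(t, X^k(t)) − k(d∇d)(x_i^k(t)) with common initial datum X° ∈ G, converging uniformly on [0,T] to X with X(t) ∈ G. Fix i and ψ ∈ C_c^∞((0,T); ℝ^m), let I_k := {t ∈ [0,T] : x_i^k(t) ∉ cl Ω}, and set B_k := ∫_{I_k} (∇d(x_i^k(t))·F_i(t,X^k(t))) (∇d(x_i^k(t))·ψ(t)) dt. Then there exists χ̄ ∈ L^∞(0,T;[0,1]) such that, along a subsequence, B_k → ∫₀^T (ν(x_i(t))·F_i(t,X(t)))₊ (ν(x_i(t))·ψ(t)) χ̄(t) χ_{∂Ω}(t) dt as k → ∞, where χ_{∂Ω}(t) = 1 if x_i(t) ∈ ∂Ω and 0 otherwise,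 and (a)₊ := max(a,0). -/
open Set MeasureTheory Filter
open scoped RealInnerProductSpace Topology NNReal ContDiff

noncomputable section

variable {m n : ℕ}

/-- Outside `cl Ω` the signed distance and the distance coincide. -/
lemma sgnDist_eq_distCl {m : ℕ} {Ω : Set (Pt m)} (hne : Ω.Nonempty) {x : Pt m}
    (hx : x ∉ closure Ω) : sgnDist Ω x = distCl Ω x := by
  have h1 : (closure Ω)ᶜ ≠ univ := by
    intro h
    obtain ⟨y, hy⟩ := hne
    have : y ∈ (closure Ω)ᶜ := by rw [h]; trivial
    exact this (subset_closure hy)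
  obtain ⟨y, hy, hxy⟩ := exists_mem_frontier_infDist_compl_eq_dist (x := x)
    (s := (closure Ω)ᶜ) hx h1
  rw [compl_compl] at hxy
  rw [frontier_compl] at hy
  have hy' : y ∈ frontier Ω := frontier_closure_subset hy
  simp only [sgnDist, distCl, if_neg hx]
  apply le_antisymm
  · rw [hxy]; exact Metric.infDist_le_dist_of_mem hy'
  · exact Metric.infDist_le_infDist_of_subset frontier_subset_closure ⟨y, hy'⟩

lemma sgnDist_eventuallyEq {m : ℕ} {Ω : Set (Pt m)} (hne : Ω.Nonempty) {x : Pt m}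
    (hx : x ∉ closure Ω) : sgnDist Ω =ᶠ[𝓝 x] distCl Ω := by
  filter_upwards [isClosed_closure.isOpen_compl.mem_nhds hx] with y hy
  exact sgnDist_eq_distCl hne hy

lemma gradient_sgnDist_eq {m : ℕ} {Ω : Set (Pt m)} (hne : Ω.Nonempty) {x : Pt m}
    (hx : x ∉ closure Ω) : gradient (sgnDist Ω) x = gradient (distCl Ω) x := by
  unfold gradient
  rw [(sgnDist_eventuallyEq hne hx).fderiv_eq]

lemma continuousAt_gradient {m : ℕ} {f : Pt m → ℝ} {x : Pt m} (h : ContDiffAt ℝ 2 f x) :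
    ContinuousAt (gradient f) x := by
  unfold gradient
  exact (InnerProductSpace.toDual ℝ (Pt m)).symm.continuous.continuousAt.comp
    (h.continuousAt_fderiv (by norm_num))

lemma norm_gradient_distCl_le {m : ℕ} (Ω : Set (Pt m)) (x : Pt m) :
    ‖gradient (distCl Ω) x‖ ≤ 1 := by
  unfold gradient
  rw [LinearIsometryEquiv.norm_map]
  exact norm_fderiv_le_of_lipschitz ℝ (C := 1) (Metric.lipschitz_infDist_pt _)

lemma measurable_gradient {m : ℕ} (f : Pt m → ℝ) : Measurable (gradient f) := by
  unfold gradient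
  exact (InnerProductSpace.toDual ℝ (Pt m)).symm.continuous.measurable.comp
    (measurable_fderiv ℝ f)

/-- A nonnegative function that decreases at rate `δ` whenever positive, and is positive at the
right endpoint, is at least `δ (b - a)` at the left endpoint. -/
lemma decay_lower_bound {u : ℝ → ℝ} {a b δ : ℝ} (hab : a ≤ b) (hδ : 0 < δ)
    (hc : ContinuousOn u (Icc a b)) (h0 : ∀ t ∈ Icc a b, 0 ≤ u t) (hb : 0 < u b)
    (hd : ∀ t ∈ Ioo a b, 0 < u t → ∃ u', HasDerivAt u u' t ∧ u' ≤ -δ) :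
    δ * (b - a) ≤ u a := by
  have key : ∀ s ∈ Icc a b, (∀ t ∈ Ioo s b, 0 < u t) → u b + δ * (b - s) ≤ u s := by
    intro s hs hpos
    have hanti : AntitoneOn (fun t => u t + δ * t) (Icc s b) := by
      apply antitoneOn_of_deriv_nonpos (convex_Icc s b)
      · exact (hc.mono (Icc_subset_Icc_left hs.1)).add (by fun_prop)
      · intro t ht
        rw [interior_Icc] at ht
        obtain ⟨u', hu', _⟩ := hd t ⟨hs.1.trans_lt ht.1, ht.2⟩ (hpos t ht)
        have := hu'.add ((hasDerivAt_id t).const_mul δ)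
        exact this.differentiableAt.differentiableWithinAt
      · intro t ht
        rw [interior_Icc] at ht
        obtain ⟨u', hu', hle⟩ := hd t ⟨hs.1.trans_lt ht.1, ht.2⟩ (hpos t ht)
        have h := hu'.add ((hasDerivAt_id t).const_mul δ)
        have h2 : deriv (fun t => u t + δ * t) t = u' + δ * 1 := h.deriv
        rw [h2]; linarith
    have := hanti (left_mem_Icc.2 hs.2) (right_mem_Icc.2 hs.2) hs.2
    simp only at this
    linarith
  by_cases hz : ∃ t ∈ Icc a b, u t = 0
  · exfalso
    have hcl : IsCompact (Icc a b ∩ u ⁻¹' {0}) :=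
      isCompact_Icc.of_isClosed_subset
        (hc.preimage_isClosed_of_isClosed isClosed_Icc isClosed_singleton) inter_subset_left
    obtain ⟨t, ht, htz⟩ := hz
    obtain ⟨s, hs, hmax⟩ := hcl.exists_isGreatest ⟨t, ht, htz⟩
    have hk := key s hs.1 (fun r hr => by
      have hr' : r ∈ Icc a b := ⟨hs.1.1.trans hr.1.le, hr.2.le⟩
      refine lt_of_le_of_ne (h0 r hr') (fun h => ?_)
      exact absurd (hmax ⟨hr', h.symm⟩) (not_le.2 hr.1))
    have hs0 : u s = 0 := hs.2
    have : 0 ≤ δ * (b - s) := mul_nonneg hδ.le (sub_nonneg.2 hs.1.2)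
    linarith
  · push Not at hz
    have hk := key a (left_mem_Icc.2 hab) (fun r hr =>
      lt_of_le_of_ne (h0 r ⟨hr.1.le, hr.2.le⟩) (hz r ⟨hr.1.le, hr.2.le⟩).symm)
    linarith

/-- Joint convergence from uniform convergence and continuity of the limit. -/
lemma joint_tendsto {E : Type*} [PseudoMetricSpace E] {f : ℕ → ℝ → E} {g : ℝ → E} {S : Set ℝ}
    (h : TendstoUniformlyOn f g atTop S) (hg : ContinuousOn g S) {t : ℝ} (ht : t ∈ S)
    {U : Set E} (hU : U ∈ 𝓝 (g t)) :
    ∃ K : ℕ, ∃ η > 0, ∀ k ≥ K, ∀ s ∈ S, |s - t| < η → f k s ∈ U := by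
  obtain ⟨r, hr, hrU⟩ := Metric.mem_nhds_iff.1 hU
  rw [Metric.tendstoUniformlyOn_iff] at h
  obtain ⟨K, hK⟩ := eventually_atTop.1 (h (r / 2) (by positivity))
  obtain ⟨η, hη, hη2⟩ := Metric.continuousOn_iff.1 hg t ht (r / 2) (by positivity)
  refine ⟨K, η, hη, fun k hk s hs hst => hrU ?_⟩
  have h1 := hK k hk s hs
  have h2 := hη2 s hs (by rwa [Real.dist_eq])
  rw [dist_comm] at h1
  rw [Metric.mem_ball]
  linarith [dist_triangle (f k s) (g s) (g t)]

/-- If the limit touches the boundary at `t` with inward force, the penalized trajectories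
are eventually in `cl Ω` at time `t`. -/
lemma eventually_mem_closure {m n : ℕ} {Ω : Set (Pt m)} {ν : Pt m → Pt m}
    (hΩ : IsC2Domain Ω ν) {T : ℝ} {F : Fin n → ℝ → Conf m n → Pt m}
    (hFc : ∀ i, Continuous (Function.uncurry (F i))) {k₀ : ℕ}
    {X0 : Conf m n} {Xk : ℕ → ℝ → Conf m n}
    (hsol : ∀ k, k₀ ≤ k → IsPenalSol Ω F T (k : ℝ) X0 (Xk k))
    {X : ℝ → Conf m n}
    (hconv : TendstoUniformlyOn (fun k t => Xk k t) X atTop (Icc 0 T))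
    (hXc : ContinuousOn X (Icc 0 T))
    (hXG : ∀ t ∈ Icc (0:ℝ) T, X t ∈ Gset Ω n)
    (i : Fin n) {t : ℝ} (ht : t ∈ Ioo 0 T) (hfr : X t i ∈ frontier Ω)
    (hneg : ⟪ν (X t i), F i t (X t)⟫ < 0) :
    ∀ᶠ k in atTop, Xk k t i ∈ closure Ω := by
  have htI : t ∈ Icc 0 T := ⟨ht.1.le, ht.2.le⟩
  set δ : ℝ := -⟪ν (X t i), F i t (X t)⟫ / 2 with hδdef
  have hδ : 0 < δ := by simp only [hδdef]; linarith
  -- the normal force is continuous near `(t, X t)`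
  have hH : ContinuousAt (fun p : ℝ × Conf m n =>
      ⟪gradient (sgnDist Ω) (p.2 i), F i p.1 p.2⟫) (t, X t) := by
    refine ContinuousAt.inner (𝕜 := ℝ) ?_ ?_
    · have h1 : ContinuousAt (gradient (sgnDist Ω)) (X t i) :=
        continuousAt_gradient (hΩ.smoothBoundary _ hfr)
      have h2 : ContinuousAt (fun p : ℝ × Conf m n => p.2 i) (t, X t) := by fun_prop
      exact ContinuousAt.comp (f := fun p : ℝ × Conf m n => p.2 i) h1 h2
    · exact (hFc i).continuousAt
  have hev : ∀ᶠ p : ℝ × Conf m n in 𝓝 (t, X t),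
      ⟪gradient (sgnDist Ω) (p.2 i), F i p.1 p.2⟫ < -δ := by
    apply hH.eventually_lt continuousAt_const
    simp only [hΩ.grad_eq_normal _ hfr, hδdef]
    linarith
  rw [nhds_prod_eq] at hev
  obtain ⟨p, hp, q, hq, hpq⟩ := eventually_prod_iff.1 hev
  have hdiff : ∀ᶠ Y : Conf m n in 𝓝 (X t), DifferentiableAt ℝ (sgnDist Ω) (Y i) := by
    have h1 : ∀ᶠ y in 𝓝 (X t i), ContDiffAt ℝ 2 (sgnDist Ω) y :=
      (hΩ.smoothBoundary _ hfr).eventually (by simp)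
    have h2 : Tendsto (fun Y : Conf m n => Y i) (𝓝 (X t)) (𝓝 (X t i)) :=
      (continuous_apply i).continuousAt
    filter_upwards [h2.eventually h1] with Y hY
    exact hY.differentiableAt (by norm_num)
  obtain ⟨K, η, hη, hK⟩ := joint_tendsto hconv hXc htI (hq.and hdiff)
  obtain ⟨η', hη', hp'⟩ := Metric.eventually_nhds_iff.1 hp
  -- left endpoint of the interval
  set c : ℝ := min (min η η') t / 2 with hc
  have hcpos : 0 < c := by
    have := lt_min (lt_min hη hη') ht.1
    simp only [hc]; linarith
  have hcη : c < η := by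
    have : min (min η η') t ≤ η := (min_le_left _ _).trans (min_le_left _ _)
    simp only [hc] at hcpos ⊢; linarith
  have hcη' : c < η' := by
    have : min (min η η') t ≤ η' := (min_le_left _ _).trans (min_le_right _ _)
    simp only [hc] at hcpos ⊢; linarith
  have hct : c < t := by
    have : min (min η η') t ≤ t := min_le_right _ _
    simp only [hc] at hcpos ⊢; linarith
  have haI : t - c ∈ Icc 0 T := ⟨by linarith, by linarith [ht.2]⟩
  have hsub : Icc (t - c) t ⊆ Icc 0 T := Icc_subset_Icc haI.1 ht.2.le
  have hunif := (Metric.tendstoUniformlyOn_iff.1 hconv) (δ * c) (by positivity)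
  filter_upwards [eventually_ge_atTop K, eventually_ge_atTop k₀, hunif] with k hkK hk0 hku
  by_contra hout
  have hpos : ∀ x : Pt m, 0 < distCl Ω x ↔ x ∉ closure Ω := by
    intro x
    exact (isClosed_closure.notMem_iff_infDist_pos hΩ.nonempty.closure).symm
  have hderiv := (hsol k hk0).2 i
  have hxc : ContinuousOn (fun s => Xk k s i) (Icc 0 T) :=
    fun s hs => (hderiv s hs).continuousWithinAt
  have hlow := decay_lower_bound (u := fun s => distCl Ω (Xk k s i)) (a := t - c) (b := t)
    (by linarith) hδ
    ((Metric.continuous_infDist_pt _).comp_continuousOn (hxc.mono hsub))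
    (fun s _ => Metric.infDist_nonneg) ((hpos _).2 hout) (by
      intro s hs hs0
      have hsI : s ∈ Ioo 0 T := ⟨by linarith [hs.1, haI.1], hs.2.trans ht.2⟩
      have hsI' : s ∈ Icc 0 T := ⟨hsI.1.le, hsI.2.le⟩
      have hst : |s - t| < c := by rw [abs_lt]; constructor <;> linarith [hs.1, hs.2]
      have hso : Xk k s i ∉ closure Ω := (hpos _).1 hs0
      obtain ⟨hq1, hq2⟩ := hK k hkK s hsI' (hst.trans hcη)
      have hlt := hpq (hp' (by rw [Real.dist_eq]; exact hst.trans hcη')) hq1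
      simp only at hlt
      rw [gradient_sgnDist_eq hΩ.nonempty hso] at hlt
      have hdd : DifferentiableAt ℝ (distCl Ω) (Xk k s i) :=
        (sgnDist_eventuallyEq hΩ.nonempty hso).differentiableAt_iff.1 hq2
      have hx := (hderiv s hsI').hasDerivAt (Icc_mem_nhds hsI.1 hsI.2)
      have hcomp := hdd.hasGradientAt.hasFDerivAt.comp_hasDerivAt s hx
      refine ⟨_, hcomp, ?_⟩
      rw [InnerProductSpace.toDual_apply_apply, inner_sub_right, dGradd, if_neg hso,
        inner_smul_right, inner_smul_right]
      have h3 : 0 ≤ (k : ℝ) * (distCl Ω (Xk k s i) *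
          ⟪gradient (distCl Ω) (Xk k s i), gradient (distCl Ω) (Xk k s i)⟫) :=
        mul_nonneg (Nat.cast_nonneg k) (mul_nonneg hs0.le real_inner_self_nonneg)
      linarith)
  have h1 : distCl Ω (Xk k (t - c) i) ≤ dist (Xk k (t - c) i) (X (t - c) i) :=
    Metric.infDist_le_dist_of_mem (hXG _ haI i)
  have h2 : dist (Xk k (t - c) i) (X (t - c) i) ≤ dist (Xk k (t - c)) (X (t - c)) :=
    dist_le_pi_dist _ _ i
  have h3 := hku _ haI
  rw [dist_comm] at h3
  have : t - (t - c) = c := by ring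
  rw [this] at hlow
  linarith

/-- Existence of a multiplier realising a prescribed value of the integral. -/
lemma exists_multiplier {μ : Measure ℝ} {w : ℝ → ℝ} (hw : Measurable w) (hwi : Integrable w μ)
    {L : ℝ} (h1 : ∫ t, min (w t) 0 ∂μ ≤ L) (h2 : L ≤ ∫ t, max (w t) 0 ∂μ) :
    ∃ χ : ℝ → ℝ, Measurable χ ∧ (∀ t, χ t ∈ Icc (0:ℝ) 1) ∧ ∫ t, w t * χ t ∂μ = L := by
  have hL : L ∈ segment ℝ (∫ t, min (w t) 0 ∂μ) (∫ t, max (w t) 0 ∂μ) := by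
    rw [segment_eq_Icc (h1.trans h2)]; exact ⟨h1, h2⟩
  obtain ⟨a, b, ha, hb, hab, rfl⟩ := hL
  have hms : MeasurableSet {t | 0 < w t} := measurableSet_lt measurable_const hw
  classical
  refine ⟨fun t => if 0 < w t then b else a, Measurable.ite hms measurable_const measurable_const,
    fun t => ?_, ?_⟩
  · dsimp only
    split_ifs
    · exact ⟨hb, by linarith⟩
    · exact ⟨ha, by linarith⟩
  · have hmin : Integrable (fun t => min (w t) 0) μ := hwi.inf (integrable_zero _ _ _)
    have hmax : Integrable (fun t => max (w t) 0) μ := hwi.sup (integrable_zero _ _ _)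
    rw [smul_eq_mul, smul_eq_mul, ← integral_const_mul, ← integral_const_mul,
      ← integral_add (hmin.const_mul a) (hmax.const_mul b)]
    congr 1
    ext t
    dsimp only
    split_ifs with h
    · rw [min_eq_right h.le, max_eq_left h.le]; ring
    · rw [min_eq_left (not_lt.1 h), max_eq_right (not_lt.1 h)]; ring

/-- **Lemma (limit of the term `B_k`).**
There is `χ̄ ∈ L^∞(0,T;[0,1])` such that, along a subsequence,
`B_k → ∫₀^T (ν(x_i)·F_i)₊ (ν(x_i)·ψ) χ̄ χ_{∂Ω} dt`. -/
theorem Bk_limit {m n : ℕ} (Ω : Set (Pt m)) (ν : Pt m → Pt m)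
    (hΩ : IsC2Domain Ω ν) (ε : ℝ) (hε : 0 < ε)
    (hd1 : ContDiffOn ℝ 2 (distCl Ω) (closure (Metric.thickening ε (frontier Ω)) \ Ω))
    (hd2 : ∀ x ∈ closure (Metric.thickening ε Ω) \ closure Ω,
      ContDiffAt ℝ 2 (distCl Ω) x)
    (T : ℝ) (hT : 0 < T) (F : Fin n → ℝ → Conf m n → Pt m)
    (hFc : ∀ i, Continuous (Function.uncurry (F i)))
    (M : ℝ) (hM : ∀ i, ∀ t ∈ Icc (0:ℝ) T, ∀ X : Conf m n, ‖F i t X‖ ≤ M)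
    (k₀ : ℕ) (hk₀ : M / ε < (k₀ : ℝ))
    (X0 : Conf m n) (hX0 : X0 ∈ Gset Ω n)
    (Xk : ℕ → ℝ → Conf m n)
    (hsol : ∀ k, k₀ ≤ k → IsPenalSol Ω F T (k : ℝ) X0 (Xk k))
    (X : ℝ → Conf m n)
    (hconv : TendstoUniformlyOn (fun k t => Xk k t) X atTop (Icc 0 T))
    (hXG : ∀ t ∈ Icc (0:ℝ) T, X t ∈ Gset Ω n)
    (i : Fin n) (ψ : ℝ → Pt m) (hψ : ContDiff ℝ ∞ ψ)
    (hψc : HasCompactSupport ψ) (hψs : tsupport ψ ⊆ Ioo 0 T) :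
    ∃ χ : ℝ → ℝ, Measurable χ ∧ (∀ t, χ t ∈ Icc (0:ℝ) 1) ∧
      ∃ φ : ℕ → ℕ, StrictMono φ ∧ (∀ k, k₀ ≤ φ k) ∧
        Tendsto (fun k => ∫ t in {t ∈ Icc (0:ℝ) T | Xk (φ k) t i ∉ closure Ω},
            ⟪gradient (distCl Ω) (Xk (φ k) t i), F i t (Xk (φ k) t)⟫ *
              ⟪gradient (distCl Ω) (Xk (φ k) t i), ψ t⟫)
          atTop
          (𝓝 (∫ t in Icc (0:ℝ) T,
            ({t : ℝ | X t i ∈ frontier Ω}).indicator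
              (fun t => max ⟪ν (X t i), F i t (X t)⟫ 0 * ⟪ν (X t i), ψ t⟫ * χ t)
              t)) := by
  have hTI : ∀ t ∈ Ioo 0 T, t ∈ Icc 0 T := fun t ht => ⟨ht.1.le, ht.2.le⟩
  have hXkc : ∀ k, k₀ ≤ k → ContinuousOn (Xk k) (Icc 0 T) := fun k hk =>
    continuousOn_pi.2 fun j s hs => ((hsol k hk).2 j s hs).continuousWithinAt
  have hXc : ContinuousOn X (Icc 0 T) :=
    hconv.continuousOn ((eventually_ge_atTop k₀).mono fun k hk => hXkc k hk).frequently
  obtain ⟨C, hC⟩ := hψ.continuous.bounded_above_of_compact_support hψc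
  have hC0 : 0 ≤ C := (norm_nonneg _).trans (hC 0)
  have hM0 : 0 ≤ M := (norm_nonneg _).trans (hM i 0 ⟨le_rfl, hT.le⟩ X0)
  -- the limit density
  set K : Set ℝ := Icc 0 T ∩ (fun t => X t i) ⁻¹' frontier Ω with hKdef
  have hXic : ContinuousOn (fun t => X t i) (Icc 0 T) :=
    (continuous_apply i).comp_continuousOn hXc
  have hKcl : IsClosed K := hXic.preimage_isClosed_of_isClosed isClosed_Icc isClosed_frontier
  have hKm : MeasurableSet K := hKcl.measurableSet
  set f : ℝ → ℝ := fun t => max ⟪ν (X t i), F i t (X t)⟫ 0 * ⟪ν (X t i), ψ t⟫ with hf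
  set w : ℝ → ℝ := K.indicator f with hwdef
  have hfc : ContinuousOn f K := by
    have hν : ContinuousOn (fun t => ν (X t i)) K := by
      have h1 : ContinuousOn (fun t => gradient (sgnDist Ω) (X t i)) K := fun t ht =>
        ContinuousAt.comp_continuousWithinAt (f := fun t => X t i)
          (continuousAt_gradient (hΩ.smoothBoundary _ ht.2))
          ((hXic t ht.1).mono inter_subset_left)
      exact h1.congr fun t ht => (hΩ.grad_eq_normal _ ht.2).symm
    have hFX : ContinuousOn (fun t => F i t (X t)) K :=
      (hFc i).comp_continuousOn (continuousOn_id.prodMk (hXc.mono inter_subset_left))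
    exact ((hν.inner (𝕜 := ℝ) hFX).sup continuousOn_const).mul
      (hν.inner (𝕜 := ℝ) hψ.continuous.continuousOn)
  have hwm : Measurable w := by
    classical
    rw [hwdef, ← Set.piecewise_eq_indicator]
    exact hfc.measurable_piecewise continuousOn_const hKm
  have hwb : ∀ t, ‖w t‖ ≤ M * C := by
    intro t
    by_cases ht : t ∈ K
    · rw [hwdef, indicator_of_mem ht, norm_mul]
      have hn := hΩ.normal_unit _ ht.2
      have h1 : |⟪ν (X t i), F i t (X t)⟫| ≤ M := by
        have := abs_real_inner_le_norm (ν (X t i)) (F i t (X t))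
        rw [hn, one_mul] at this
        exact this.trans (hM i t ht.1 _)
      have h2 : |⟪ν (X t i), ψ t⟫| ≤ C := by
        have := abs_real_inner_le_norm (ν (X t i)) (ψ t)
        rw [hn, one_mul] at this
        exact this.trans (hC t)
      have h3 : ‖max ⟪ν (X t i), F i t (X t)⟫ 0‖ ≤ M := by
        rw [Real.norm_eq_abs, abs_of_nonneg (le_max_right _ _)]
        exact max_le ((le_abs_self _).trans h1) hM0
      exact mul_le_mul h3 h2 (norm_nonneg _) hM0
    · rw [hwdef, indicator_of_notMem ht, norm_zero]; positivity
  set μ : Measure ℝ := volume.restrict (Icc 0 T) with hμ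
  have hwi : Integrable w μ :=
    Integrable.of_bound hwm.aestronglyMeasurable (M * C) (Eventually.of_forall hwb)
  -- the penalized quantities
  set I : ℕ → Set ℝ := fun k => {t ∈ Icc (0:ℝ) T | Xk k t i ∉ closure Ω} with hI
  have hIm : ∀ k, k₀ ≤ k → MeasurableSet (I k) := by
    intro k hk
    have h1 : IsClosed (Icc 0 T ∩ (fun t => Xk k t i) ⁻¹' closure Ω) :=
      ((continuous_apply i).comp_continuousOn (hXkc k hk)).preimage_isClosed_of_isClosed
        isClosed_Icc isClosed_closure
    have h2 : I k = Icc 0 T \ (Icc 0 T ∩ (fun t => Xk k t i) ⁻¹' closure Ω) := by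
      ext t
      simp only [hI, mem_ofPred_eq, Set.mem_sdiff, mem_inter_iff, mem_preimage]
      tauto
    rw [h2]
    exact measurableSet_Icc.diff h1.measurableSet
  set g : ℕ → ℝ → ℝ := fun k t =>
    ⟪gradient (distCl Ω) (Xk k t i), F i t (Xk k t)⟫ *
      ⟪gradient (distCl Ω) (Xk k t i), ψ t⟫ with hg
  have hgm : ∀ k, k₀ ≤ k → AEStronglyMeasurable (g k) μ := by
    intro k hk
    have h0 : AEMeasurable (fun t => Xk k t i) μ :=
      ((continuous_apply i).comp_continuousOn (hXkc k hk)).aemeasurable measurableSet_Icc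
    have h1 : AEMeasurable (fun t => gradient (distCl Ω) (Xk k t i)) μ :=
      (measurable_gradient (distCl Ω)).comp_aemeasurable h0
    have h2 : AEMeasurable (fun t => F i t (Xk k t)) μ :=
      ((hFc i).comp_continuousOn
        (continuousOn_id.prodMk (hXkc k hk))).aemeasurable measurableSet_Icc
    have h3 : AEMeasurable ψ μ := hψ.continuous.measurable.aemeasurable
    exact ((h1.inner h2).mul (h1.inner h3)).aestronglyMeasurable
  have hgb : ∀ k, ∀ t ∈ Icc 0 T, ‖g k t‖ ≤ M * C := by
    intro k t ht
    have hn := norm_gradient_distCl_le Ω (Xk k t i)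
    have h1 : ‖⟪gradient (distCl Ω) (Xk k t i), F i t (Xk k t)⟫‖ ≤ M :=
      (norm_inner_le_norm _ _).trans
        ((mul_le_of_le_one_left (norm_nonneg _) hn).trans (hM i t ht _))
    have h2 : ‖⟪gradient (distCl Ω) (Xk k t i), ψ t⟫‖ ≤ C :=
      (norm_inner_le_norm _ _).trans
        ((mul_le_of_le_one_left (norm_nonneg _) hn).trans (hC t))
    simp only [hg]
    rw [norm_mul]
    exact mul_le_mul h1 h2 (norm_nonneg _) hM0
  -- pointwise convergence of the error
  have hpt : ∀ t ∈ Ioo 0 T,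
      Tendsto (fun k => (I k).indicator (fun s => g k s - w s) t) atTop (𝓝 0) := by
    intro t ht
    have htI := hTI t ht
    have hXt : Tendsto (fun k => Xk k t) atTop (𝓝 (X t)) := hconv.tendsto_at htI
    have hXti : Tendsto (fun k => Xk k t i) atTop (𝓝 (X t i)) :=
      (continuous_apply i).continuousAt.tendsto.comp hXt
    have hzero : (∀ᶠ k in atTop, Xk k t i ∈ closure Ω) →
        Tendsto (fun k => (I k).indicator (fun s => g k s - w s) t) atTop (𝓝 0) := by
      intro h
      refine tendsto_const_nhds.congr' ?_
      filter_upwards [h] with k hk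
      rw [indicator_of_notMem]
      exact fun h => h.2 hk
    by_cases hfr : X t i ∈ frontier Ω
    · rcases lt_or_ge ⟪ν (X t i), F i t (X t)⟫ 0 with hneg | hnn
      · exact hzero (eventually_mem_closure hΩ hFc hsol hconv hXc hXG i ht hfr hneg)
      · have hwt : w t = ⟪ν (X t i), F i t (X t)⟫ * ⟪ν (X t i), ψ t⟫ := by
          rw [hwdef, indicator_of_mem (show t ∈ K from ⟨htI, hfr⟩)]
          simp only [hf, max_eq_left hnn]
        have hgr : Tendsto (fun k => gradient (sgnDist Ω) (Xk k t i)) atTop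
            (𝓝 (ν (X t i))) := by
          have := (continuousAt_gradient (hΩ.smoothBoundary _ hfr)).tendsto
          rw [hΩ.grad_eq_normal _ hfr] at this
          exact this.comp hXti
        have hFt : Tendsto (fun k => F i t (Xk k t)) atTop (𝓝 (F i t (X t))) :=
          ((hFc i).tendsto (t, X t)).comp (tendsto_const_nhds.prodMk_nhds hXt)
        have hS : Tendsto (fun k => ⟪gradient (sgnDist Ω) (Xk k t i), F i t (Xk k t)⟫ *
            ⟪gradient (sgnDist Ω) (Xk k t i), ψ t⟫ - w t) atTop (𝓝 0) := by
          have := ((hgr.inner (𝕜 := ℝ) hFt).mul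
            (hgr.inner (𝕜 := ℝ) (tendsto_const_nhds (x := ψ t)))).sub_const (w t)
          rwa [← hwt, sub_self] at this
        have hS' := hS.norm
        rw [norm_zero] at hS'
        refine squeeze_zero_norm (fun k => ?_) hS'
        by_cases hk : t ∈ I k
        · rw [indicator_of_mem hk, gradient_sgnDist_eq hΩ.nonempty hk.2]
        · rw [indicator_of_notMem hk, norm_zero]
          exact norm_nonneg _
    · refine hzero ?_
      have hmem : X t i ∈ Ω := by
        have h1 : X t i ∈ closure Ω := hXG t htI i
        rw [hΩ.isOpen.frontier_eq] at hfr
        by_contra h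
        exact hfr ⟨h1, h⟩
      filter_upwards [hXti.eventually (hΩ.isOpen.mem_nhds hmem)] with k hk
      exact subset_closure hk
  have herr : Tendsto (fun k => ∫ t, (I (k₀ + k)).indicator (fun s => g (k₀ + k) s - w s) t ∂μ)
      atTop (𝓝 0) := by
    have hlim := tendsto_integral_of_dominated_convergence (μ := μ)
      (F := fun k t => (I (k₀ + k)).indicator (fun s => g (k₀ + k) s - w s) t)
      (f := fun _ => (0:ℝ)) (fun _ => M * C + M * C)
      (fun k => ((hgm _ (Nat.le_add_right _ _)).sub hwm.aestronglyMeasurable).indicator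
        (hIm _ (Nat.le_add_right _ _)))
      (integrable_const _) (fun k => ?_) ?_
    · simpa using hlim
    · refine (ae_restrict_iff' measurableSet_Icc).2 (Eventually.of_forall fun t ht => ?_)
      refine (norm_indicator_le_norm_self _ _).trans ?_
      exact (norm_sub_le _ _).trans (add_le_add (hgb _ t ht) (hwb t))
    · have hshift : Tendsto (fun k => k₀ + k) atTop atTop := tendsto_add_atTop_nat k₀ |>.congr
        fun k => Nat.add_comm _ _
      rw [hμ, ← restrict_Ioo_eq_restrict_Icc]
      exact (ae_restrict_iff' measurableSet_Ioo).2
        (Eventually.of_forall fun t ht => (hpt t ht).comp hshift)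
  -- the reduced integrals lie in a compact interval
  have hmin : Integrable (fun t => min (w t) 0) μ := hwi.inf (integrable_zero _ _ _)
  have hmax : Integrable (fun t => max (w t) 0) μ := hwi.sup (integrable_zero _ _ _)
  have hbd : ∀ k, ∫ t, (I (k₀ + k)).indicator w t ∂μ ∈
      Icc (∫ t, min (w t) 0 ∂μ) (∫ t, max (w t) 0 ∂μ) := by
    intro k
    have hii := hwi.indicator (hIm (k₀ + k) (Nat.le_add_right _ _))
    constructor
    · refine integral_mono hmin hii fun t => ?_
      by_cases h : t ∈ I (k₀ + k)
      · simp [indicator_of_mem h]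
      · simp [indicator_of_notMem h]
    · refine integral_mono hii hmax fun t => ?_
      by_cases h : t ∈ I (k₀ + k)
      · simp [indicator_of_mem h]
      · simp [indicator_of_notMem h]
  obtain ⟨L, hL, ρ, hρ, hρL⟩ := isCompact_Icc.tendsto_subseq hbd
  obtain ⟨χ, hχm, hχ01, hχL⟩ := exists_multiplier hwm hwi hL.1 hL.2
  refine ⟨χ, hχm, hχ01, fun k => k₀ + ρ k, fun a b hab => by simpa using hρ hab,
    fun k => Nat.le_add_right _ _, ?_⟩
  have hgoal : ∫ t in Icc (0:ℝ) T, ({t : ℝ | X t i ∈ frontier Ω}).indicator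
      (fun t => max ⟪ν (X t i), F i t (X t)⟫ 0 * ⟪ν (X t i), ψ t⟫ * χ t) t = L := by
    rw [← hχL]
    refine setIntegral_congr_fun measurableSet_Icc fun t ht => ?_
    by_cases h : X t i ∈ frontier Ω
    · have h' : t ∈ K := ⟨ht, h⟩
      simp only [hwdef, indicator_of_mem h']
      rw [indicator_of_mem (show t ∈ {t : ℝ | X t i ∈ frontier Ω} from h)]
    · have h' : t ∉ K := fun hh => h hh.2
      simp only [hwdef, indicator_of_notMem h', zero_mul]
      rw [indicator_of_notMem (show t ∉ {t : ℝ | X t i ∈ frontier Ω} from h)]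
  rw [hgoal]
  have hsum := (herr.comp hρ.tendsto_atTop).add hρL
  rw [zero_add] at hsum
  refine hsum.congr fun k => ?_
  have hk : k₀ ≤ k₀ + ρ k := Nat.le_add_right _ _
  have hmI := hIm _ hk
  simp only [Function.comp]
  have hgi : Integrable (g (k₀ + ρ k)) μ := Integrable.of_bound (hgm _ hk) (M * C)
    ((ae_restrict_iff' measurableSet_Icc).2 (Eventually.of_forall (hgb _)))
  have hdi : Integrable ((I (k₀ + ρ k)).indicator (fun s => g (k₀ + ρ k) s - w s)) μ :=
    (hgi.sub hwi).indicator hmI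
  rw [← integral_add hdi (hwi.indicator hmI)]
  have hIsub : Icc 0 T ∩ I (k₀ + ρ k) = I (k₀ + ρ k) := inter_eq_right.2 fun t ht => ht.1
  have hset : ∫ t in I (k₀ + ρ k), g (k₀ + ρ k) t =
      ∫ t, (I (k₀ + ρ k)).indicator (g (k₀ + ρ k)) t ∂μ := by
    rw [hμ, setIntegral_indicator hmI, hIsub]
  refine Eq.trans ?_ hset.symm
  congr 1
  ext t
  by_cases h : t ∈ I (k₀ + ρ k)
  · simp [indicator_of_mem h]
  · simp [indicator_of_notMem h]
end
end

section
/- Suppose each F_i ∈ C([0,T] × G; ℝ^m) satisfies the Lipschitz condition |F_i(t,X) − F_i(t,Y)| ≤ L‖X − Y‖ and let X = {x_i}, Y = {y_i} be two mild solutions of the confined particle system on [0,T]. Then there exists a constant C > 0, independent of X and Y, such that for every i ∈ {1,…,n} and almost every t ∈ [0,T]: (d/dt)(½|x_i(t) − y_i(t)|²) ≤ C‖X(t) − Y(t)‖². -/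
open Set MeasureTheory Filter
open scoped RealInnerProductSpace Topology NNReal ContDiff

noncomputable section

variable {m n : ℕ}

lemma aux_inner_grad (f : Pt m → ℝ) (x v : Pt m) : fderiv ℝ f x v = ⟪gradient f x, v⟫ := by
  simp [gradient]

lemma aux_sgn_frontier (Ω : Set (Pt m)) {x : Pt m} (hx : x ∈ frontier Ω) : sgnDist Ω x = 0 := by
  simp [sgnDist, frontier_subset_closure hx, Metric.infDist_zero_of_mem hx]

lemma aux_sgn_closure (Ω : Set (Pt m)) {x : Pt m} (hx : x ∈ closure Ω) : sgnDist Ω x ≤ 0 := by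
  simp [sgnDist, hx, Metric.infDist_nonneg]

lemma aux_local (Ω : Set (Pt m)) (ν : Pt m → Pt m) (hΩ : IsC2Domain Ω ν) (x0 : Pt m)
    (hx0 : x0 ∈ frontier Ω) :
    ∃ t ∈ 𝓝 x0, ∃ K : ℝ, 0 ≤ K ∧ ∀ x ∈ t, x ∈ frontier Ω → ∀ y ∈ closure Ω,
      ⟪ν x, y - x⟫ ≤ K * ‖y - x‖ ^ 2 := by
  have hc := hΩ.smoothBoundary x0 hx0
  obtain ⟨K, t, ht, hK⟩ := (hc.fderiv_right (m := 1) (by norm_num)).exists_lipschitzOnWith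
  have hev := hc.eventually (by simp)
  obtain ⟨r, hr, hball⟩ := Metric.mem_nhds_iff.1 (Filter.inter_mem ht hev)
  refine ⟨Metric.ball x0 (r/2), Metric.ball_mem_nhds _ (by positivity), K + 2 / r,
    by positivity, ?_⟩
  intro x hx hxf y hy
  have hxr : x ∈ Metric.ball x0 r := Metric.ball_subset_ball (by linarith) hx
  by_cases hyx : ‖y - x‖ < r / 2
  · have hyr : y ∈ Metric.ball x0 r := by
      rw [Metric.mem_ball] at hx ⊢
      have := dist_triangle y x x0
      rw [dist_eq_norm y x] at this
      linarith
    have hconv : Convex ℝ (Metric.ball x0 r ∩ Metric.closedBall x ‖y - x‖) :=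
      (convex_ball _ _).inter (convex_closedBall _ _)
    have key := hconv.norm_image_sub_le_of_norm_fderiv_le' (𝕜 := ℝ) (f := sgnDist Ω)
      (φ := fderiv ℝ (sgnDist Ω) x) (C := K * ‖y - x‖) (x := x) (y := y)
      (fun z hz => ContDiffAt.differentiableAt (n := 2)
        (show ContDiffAt ℝ 2 (sgnDist Ω) z from (hball hz.1).2) (by simp))
      (fun z hz => by
        have h1 := hK.dist_le_mul z (hball hz.1).1 x (hball hxr).1
        rw [dist_eq_norm] at h1
        refine h1.trans ?_
        have := Metric.mem_closedBall.1 hz.2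
        gcongr)
      ⟨hxr, by simp⟩ ⟨hyr, by simp [dist_eq_norm]⟩
    rw [aux_inner_grad, hΩ.grad_eq_normal x hxf, aux_sgn_frontier Ω hxf] at key
    have h2 := aux_sgn_closure Ω hy
    have h3 := neg_le_of_abs_le key
    have h4 : 0 ≤ 2 / r * ‖y - x‖ ^ 2 := by positivity
    nlinarith
  · push Not at hyx
    have h1 := real_inner_le_norm (ν x) (y - x)
    rw [hΩ.normal_unit x hxf, one_mul] at h1
    have h2 : 1 ≤ 2 / r * ‖y - x‖ := by
      rw [div_mul_eq_mul_div, le_div_iff₀ hr]; linarith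
    have h3 : 0 ≤ (K : ℝ) * ‖y - x‖ ^ 2 := by positivity
    nlinarith [norm_nonneg (y - x)]

lemma aux_global (Ω : Set (Pt m)) (ν : Pt m → Pt m) (hΩ : IsC2Domain Ω ν) :
    ∃ K : ℝ, 0 ≤ K ∧ ∀ x ∈ frontier Ω, ∀ y ∈ closure Ω,
      ⟪ν x, y - x⟫ ≤ K * ‖y - x‖ ^ 2 := by
  have hcomp : IsCompact (frontier Ω) :=
    hΩ.bounded.isCompact_closure.of_isClosed_subset isClosed_frontier frontier_subset_closure
  have := hcomp.induction_on (p := fun s => ∃ K : ℝ, 0 ≤ K ∧ ∀ x ∈ s, x ∈ frontier Ω →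
      ∀ y ∈ closure Ω, ⟪ν x, y - x⟫ ≤ K * ‖y - x‖ ^ 2)
    ⟨0, le_rfl, by simp⟩
    (fun s t hst ⟨K, h0, h⟩ => ⟨K, h0, fun x hx => h x (hst hx)⟩)
    (fun s t ⟨K, h0, h⟩ ⟨K', h0', h'⟩ => ⟨max K K', h0.trans (le_max_left _ _), by
      rintro x (hx | hx) hxf y hy
      · exact (h x hx hxf y hy).trans (by gcongr; exact le_max_left _ _)
      · exact (h' x hx hxf y hy).trans (by gcongr; exact le_max_right _ _)⟩)
    (fun x hx => by
      obtain ⟨t, ht, h⟩ := aux_local Ω ν hΩ x hx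
      exact ⟨t, mem_nhdsWithin_of_mem_nhds ht, h⟩)
  obtain ⟨K, h0, h⟩ := this
  exact ⟨K, h0, fun x hx => h x hx hx⟩

lemma aux_nu_cont (Ω : Set (Pt m)) (ν : Pt m → Pt m) (hΩ : IsC2Domain Ω ν) :
    ContinuousOn ν (frontier Ω) := by
  have : ContinuousOn (gradient (sgnDist Ω)) (frontier Ω) := by
    intro x hx
    apply ContinuousAt.continuousWithinAt
    have h := ((hΩ.smoothBoundary x hx).fderiv_right (m := 1) (by norm_num)).continuousAt
    exact (LinearIsometryEquiv.continuous _).continuousAt.comp h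
  exact this.congr fun x hx => (hΩ.grad_eq_normal x hx).symm

/-- The projected force is the force minus a nonnegative bounded multiple of the normal. -/
lemma aux_oneProj (Ω : Set (Pt m)) (ν : Pt m → Pt m) (hΩ : IsC2Domain Ω ν) (x f : Pt m) :
    ∃ l : ℝ, 0 ≤ l ∧ l ≤ ‖f‖ ∧ (x ∉ frontier Ω → l = 0) ∧ oneProj Ω ν x f = f - l • ν x := by
  by_cases h : x ∈ frontier Ω ∧ 0 < ⟪f, ν x⟫
  · refine ⟨⟪f, ν x⟫, h.2.le, ?_, fun h' => absurd h.1 h', by simp [oneProj, h]⟩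
    have := real_inner_le_norm f (ν x)
    rwa [hΩ.normal_unit x h.1, mul_one] at this
  · refine ⟨0, le_rfl, norm_nonneg _, fun _ => rfl, ?_⟩
    rw [oneProj, if_neg h]; simp

lemma aux_oneProj_norm (Ω : Set (Pt m)) (ν : Pt m → Pt m) (hΩ : IsC2Domain Ω ν) (x f : Pt m) :
    ‖oneProj Ω ν x f‖ ≤ 2 * ‖f‖ := by
  obtain ⟨l, h0, h1, h2, h3⟩ := aux_oneProj Ω ν hΩ x f
  rw [h3]
  have h4 : ‖l • ν x‖ ≤ ‖f‖ := by
    by_cases hx : x ∈ frontier Ω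
    · rw [norm_smul, hΩ.normal_unit x hx, mul_one, Real.norm_of_nonneg h0]; exact h1
    · simp [h2 hx]
  linarith [norm_sub_le f (l • ν x)]

lemma aux_hasDeriv (Ω : Set (Pt m)) (ν : Pt m → Pt m)
    (hΩ : IsC2Domain Ω ν) (T : ℝ) (hT : 0 < T)
    (F : Fin n → ℝ → Conf m n → Pt m)
    (hF : ∀ i, ContinuousOn (fun p : ℝ × Conf m n => F i p.1 p.2)
      (Icc 0 T ×ˢ Gset Ω n)) (X0 : Conf m n) (X : ℝ → Conf m n)
    (hX : IsMildSol Ω ν F T X0 X) (i : Fin n) :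
    ∀ᵐ t ∂(volume.restrict (Icc 0 T)),
      HasDerivWithinAt (fun s => X s i) (oneProj Ω ν (X t i) (F i t (X t))) (Icc 0 T) t := by
  obtain ⟨hc, hcl, hint⟩ := hX
  have hXc : ContinuousOn X (Icc 0 T) := continuousOn_pi.2 hc
  have hFc : ContinuousOn (fun s => F i s (X s)) (Icc 0 T) :=
    (hF i).comp (continuousOn_id.prodMk hXc) fun s hs => ⟨hs, hcl s hs⟩
  set g : ℝ → Pt m := fun s => oneProj Ω ν (X s i) (F i s (X s)) with hg
  set A : Set ℝ := Icc 0 T ∩ (fun s => X s i) ⁻¹' frontier Ω with hA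
  have hAc : IsClosed A := (hc i).preimage_isClosed_of_isClosed isClosed_Icc isClosed_frontier
  have hm1 : AEStronglyMeasurable g (volume.restrict A) := by
    have hν : ContinuousOn (fun s => ν (X s i)) A :=
      (aux_nu_cont Ω ν hΩ).comp ((hc i).mono inter_subset_left) fun s hs => hs.2
    have hf : ContinuousOn (fun s => F i s (X s)) A := hFc.mono inter_subset_left
    have : ContinuousOn (fun s => F i s (X s) - (max ⟪F i s (X s), ν (X s i)⟫ 0) • ν (X s i)) A :=
      hf.sub ((ContinuousOn.sup (ContinuousOn.inner (𝕜 := ℝ) hf hν) continuousOn_const).smul hν)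
    refine (this.congr fun s hs => ?_).aestronglyMeasurable hAc.measurableSet
    simp only [hg, oneProj]
    have hs2 : X s i ∈ frontier Ω := hs.2
    by_cases h : 0 < ⟪F i s (X s), ν (X s i)⟫
    · rw [if_pos ⟨hs2, h⟩, max_eq_left h.le]
    · rw [if_neg (fun h' => h h'.2), max_eq_right (not_lt.1 h)]; simp
  have hm2 : AEStronglyMeasurable g (volume.restrict (Icc 0 T \ A)) := by
    refine ((hFc.mono sdiff_subset).congr fun s hs => ?_).aestronglyMeasurable
      (measurableSet_Icc.diff hAc.measurableSet)
    simp only [hg, oneProj]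
    rw [if_neg]
    exact fun h => hs.2 ⟨hs.1, h.1⟩
  have hm : AEStronglyMeasurable g (volume.restrict (Icc 0 T)) := by
    have := aestronglyMeasurable_union_iff.2 ⟨hm1, hm2⟩
    rwa [union_sdiff_cancel inter_subset_left] at this
  obtain ⟨M, hM⟩ := isCompact_Icc.exists_bound_of_continuousOn hFc
  have hgi : IntegrableOn g (Icc 0 T) := by
    refine IntegrableOn.of_bound (by simp) hm (2 * M) ?_
    refine (ae_restrict_iff' measurableSet_Icc).2 (Eventually.of_forall fun s hs => ?_)
    exact (aux_oneProj_norm Ω ν hΩ _ _).trans (by linarith [hM s hs])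
  have hgi' : IntervalIntegrable g volume 0 T :=
    (intervalIntegrable_iff_integrableOn_Icc_of_le hT.le).2 hgi
  rw [ae_restrict_iff' measurableSet_Icc]
  filter_upwards [hgi'.ae_hasDerivAt_integral] with t ht htI
  have htu : t ∈ uIcc 0 T := by rwa [uIcc_of_le hT.le]
  have h0u : (0:ℝ) ∈ uIcc 0 T := left_mem_uIcc
  have h := ((ht htu 0 h0u).const_add (X0 i)).hasDerivWithinAt (s := Icc 0 T)
  exact h.congr (fun s hs => hint s hs i) (hint t htI i)

/-- **Lemma (Gronwall-type estimate for two mild solutions).**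
There is `C > 0`, independent of the mild solutions `X` and `Y`, such that for
every `i` and a.e. `t ∈ [0,T]`, `(d/dt)(½|x_i − y_i|²) ≤ C‖X − Y‖²`. -/
theorem mildSol_derivative_estimate {m n : ℕ} (Ω : Set (Pt m)) (ν : Pt m → Pt m)
    (hΩ : IsC2Domain Ω ν) (T : ℝ) (hT : 0 < T)
    (F : Fin n → ℝ → Conf m n → Pt m)
    (hF : ∀ i, ContinuousOn (fun p : ℝ × Conf m n => F i p.1 p.2)
      (Icc 0 T ×ˢ Gset Ω n))
    (L : ℝ) (hL : 0 < L)
    (hLip : ∀ i, ∀ t ∈ Icc (0:ℝ) T, ∀ X Y : Conf m n,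
      ‖F i t X - F i t Y‖ ≤ L * ‖X - Y‖) :
    ∃ C > (0:ℝ), ∀ (X0 Y0 : Conf m n) (X Y : ℝ → Conf m n),
      IsMildSol Ω ν F T X0 X → IsMildSol Ω ν F T Y0 Y →
      ∀ i, ∀ᵐ t ∂(volume.restrict (Icc 0 T)), ∀ J : ℝ,
        HasDerivWithinAt (fun s => (1/2) * ‖X s i - Y s i‖ ^ 2) J (Icc 0 T) t →
        J ≤ C * ‖X t - Y t‖ ^ 2 := by
  obtain ⟨K, hK0, hK⟩ := aux_global Ω ν hΩ
  have hGc : IsCompact (Gset Ω n) := by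
    have := isCompact_univ_pi (fun _ : Fin n => hΩ.bounded.isCompact_closure)
    convert this using 1
    ext X; simp [Gset]
  have hB : ∀ i, ∃ M, ∀ p ∈ Icc 0 T ×ˢ Gset Ω n, ‖F i p.1 p.2‖ ≤ M := fun i =>
    (isCompact_Icc.prod hGc).exists_bound_of_continuousOn (hF i)
  choose B hB using hB
  set M : ℝ := ∑ i, |B i| with hMdef
  have hM0 : 0 ≤ M := Finset.sum_nonneg fun _ _ => abs_nonneg _
  have hM : ∀ i, ∀ p ∈ Icc 0 T ×ˢ Gset Ω n, ‖F i p.1 p.2‖ ≤ M := fun i p hp =>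
    ((hB i p hp).trans (le_abs_self _)).trans
      (Finset.single_le_sum (f := fun i => |B i|) (fun _ _ => abs_nonneg _) (Finset.mem_univ i))
  refine ⟨L + 2 * (M * K), by positivity, ?_⟩
  intro X0 Y0 X Y hX hY i
  filter_upwards [aux_hasDeriv Ω ν hΩ T hT F hF X0 X hX i,
    aux_hasDeriv Ω ν hΩ T hT F hF Y0 Y hY i, ae_restrict_mem measurableSet_Icc] with t hx hy ht J hJ
  have hd := ((hx.sub hy).norm_sq).const_mul (1/2 : ℝ)
  have hJeq := (uniqueDiffOn_Icc hT t ht).eq_deriv _ hJ hd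
  have hXt := hX.2.1 t ht
  have hYt := hY.2.1 t ht
  obtain ⟨a, ha0, ha1, ha2, ha3⟩ := aux_oneProj Ω ν hΩ (X t i) (F i t (X t))
  obtain ⟨b, hb0, hb1, hb2, hb3⟩ := aux_oneProj Ω ν hΩ (Y t i) (F i t (Y t))
  replace ha1 := ha1.trans (hM i (t, X t) ⟨ht, hXt⟩)
  replace hb1 := hb1.trans (hM i (t, Y t) ⟨ht, hYt⟩)
  set N := ‖X t - Y t‖ with hN
  have hxy : ‖X t i - Y t i‖ ≤ N := norm_le_pi_norm (X t - Y t) i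
  have hxy2 : ‖X t i - Y t i‖ ^ 2 ≤ N ^ 2 := by gcongr
  have hKN : 0 ≤ K * N ^ 2 := by positivity
  have e1 : ⟪X t i - Y t i, F i t (X t) - F i t (Y t)⟫ ≤ L * N ^ 2 := by
    refine (real_inner_le_norm _ _).trans ?_
    calc _ ≤ N * (L * N) := by
          gcongr
          exact hLip i t ht _ _
      _ = _ := by ring
  have e2 : a * ⟪ν (X t i), Y t i - X t i⟫ ≤ M * (K * N ^ 2) := by
    by_cases h : X t i ∈ frontier Ω
    · have := hK _ h _ (hYt i)
      rw [norm_sub_rev] at this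
      calc _ ≤ a * (K * N ^ 2) := by
            gcongr
            exact this.trans (by gcongr)
        _ ≤ _ := by gcongr
    · rw [ha2 h]; simp only [zero_mul]; positivity
  have e3 : b * ⟪ν (Y t i), X t i - Y t i⟫ ≤ M * (K * N ^ 2) := by
    by_cases h : Y t i ∈ frontier Ω
    · have := hK _ h _ (hXt i)
      calc _ ≤ b * (K * N ^ 2) := by
            gcongr
            exact this.trans (by gcongr)
        _ ≤ _ := by gcongr
    · rw [hb2 h]; simp only [zero_mul]; positivity
  have hid : J = ⟪X t i - Y t i, F i t (X t) - F i t (Y t)⟫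
      + a * ⟪ν (X t i), Y t i - X t i⟫ + b * ⟪ν (Y t i), X t i - Y t i⟫ := by
    rw [hJeq, ha3, hb3]
    simp only [Pi.sub_apply, inner_sub_left, inner_sub_right, inner_smul_right,
      real_inner_comm (ν (X t i)), real_inner_comm (ν (Y t i))]
    ring
  rw [hid]
  linarith
end
end

section
/- Suppose each F_i ∈ C([0,T] × G; ℝ^m) and let X = {x_i} be a mild solution of the confined particle system on [0,T]. If x_i(t₀) ∈ ∂Ω for some t₀ ∈ (0,T] and some i, then F_i(t₀, X(t₀)) · ν(x_i(t₀)) ≥ 0. -/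
open Set MeasureTheory Filter
open scoped RealInnerProductSpace Topology NNReal ContDiff

noncomputable section

variable {m n : ℕ}

/-- **Proposition (no inward force at boundary points of mild solutions).**
If `X` is a mild solution and `x_i(t₀) ∈ ∂Ω` for some `t₀ ∈ (0,T]`, then
`F_i(t₀, X(t₀)) · ν(x_i(t₀)) ≥ 0`. -/
theorem mildSol_boundary_force_nonneg {m n : ℕ} (Ω : Set (Pt m)) (ν : Pt m → Pt m)
    (hΩ : IsC2Domain Ω ν) (T : ℝ) (hT : 0 < T)
    (F : Fin n → ℝ → Conf m n → Pt m)
    (hF : ∀ i, ContinuousOn (fun p : ℝ × Conf m n => F i p.1 p.2)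
      (Icc 0 T ×ˢ Gset Ω n))
    (X0 : Conf m n) (X : ℝ → Conf m n) (hX : IsMildSol Ω ν F T X0 X)
    (i : Fin n) (t₀ : ℝ) (ht₀ : t₀ ∈ Ioc (0:ℝ) T)
    (hbdry : X t₀ i ∈ frontier Ω) :
    0 ≤ ⟪F i t₀ (X t₀), ν (X t₀ i)⟫ := by
  obtain ⟨hXc, hXcl, hXint⟩ := hX
  by_contra hneg
  push Not at hneg
  have hgrad : ∀ x ∈ frontier Ω, ContinuousAt (gradient (sgnDist Ω)) x := by
    intro x hx
    have h1 : ContinuousAt (fderiv ℝ (sgnDist Ω)) x :=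
      ((hΩ.smoothBoundary x hx).fderiv_right (m := 1) (by norm_num)).continuousAt
    exact (InnerProductSpace.toDual ℝ (Pt m)).symm.continuous.continuousAt.comp h1
  have hXC : ContinuousOn X (Icc 0 T) := continuousOn_pi.2 hXc
  have hFX : ContinuousOn (fun s => F i s (X s)) (Icc 0 T) :=
    (hF i).comp (f := fun s => (s, X s)) (continuousOn_id.prodMk hXC)
      (fun s hs => ⟨hs, fun j => hXcl s hs j⟩)
  set H : ℝ → Pt m := fun s => oneProj Ω ν (X s i) (F i s (X s)) with hH
  -- integrability of `H`
  have hHint : IntegrableOn H (Icc 0 T) := by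
    have hKc : IsClosed (Icc 0 T ∩ (fun s => X s i) ⁻¹' frontier Ω) :=
      (hXc i).preimage_isClosed_of_isClosed isClosed_Icc isClosed_frontier
    set K := Icc 0 T ∩ (fun s => X s i) ⁻¹' frontier Ω with hK
    have hKcomp : IsCompact K := isCompact_Icc.of_isClosed_subset hKc inter_subset_left
    have h1 : IntegrableOn H K := by
      have hg : ContinuousOn (fun s => F i s (X s) -
          max 0 ⟪F i s (X s), gradient (sgnDist Ω) (X s i)⟫ •
            gradient (sgnDist Ω) (X s i)) K := by
        have hf : ContinuousOn (fun s => F i s (X s)) K := hFX.mono inter_subset_left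
        have hn : ContinuousOn (fun s => gradient (sgnDist Ω) (X s i)) K := by
          intro s hs
          exact ContinuousAt.comp_continuousWithinAt (f := fun t => X t i) (hgrad _ hs.2)
            (((hXc i).mono inter_subset_left) s hs)
        have hi : ContinuousOn
            (fun s => max 0 ⟪F i s (X s), gradient (sgnDist Ω) (X s i)⟫) K :=
          continuousOn_const.sup (hf.inner (𝕜 := ℝ) hn)
        exact hf.sub (hi.smul hn)
      refine (hg.integrableOn_compact hKcomp).congr_fun ?_ hKc.measurableSet
      intro s hs
      simp only [hH, oneProj]
      rw [hΩ.grad_eq_normal _ hs.2]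
      have hs2 : X s i ∈ frontier Ω := hs.2
      split_ifs with h
      · rw [max_eq_right h.2.le]
      · have : ⟪F i s (X s), ν (X s i)⟫ ≤ 0 := by
          by_contra h'
          exact h ⟨hs2, not_le.1 h'⟩
        rw [max_eq_left this]; simp
    have h2 : IntegrableOn H (Icc 0 T \ K) := by
      refine (hFX.integrableOn_Icc.mono_set sdiff_subset).congr_fun ?_
        (measurableSet_Icc.diff hKc.measurableSet)
      intro s hs
      have : X s i ∉ frontier Ω := fun h => hs.2 ⟨hs.1, h⟩
      simp [hH, oneProj, this]
    exact (h1.union h2).mono_set (fun s hs => by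
      by_cases h : s ∈ K
      · exact Or.inl h
      · exact Or.inr ⟨hs, h⟩)
  have ht₀' : t₀ ∈ Icc 0 T := ⟨ht₀.1.le, ht₀.2⟩
  have hev : ∀ᶠ s in 𝓝[Icc 0 T] t₀, H s = F i s (X s) := by
    have hc : ContinuousWithinAt
        (fun s => ⟪F i s (X s), gradient (sgnDist Ω) (X s i)⟫) (Icc 0 T) t₀ :=
      (hFX t₀ ht₀').inner
        (ContinuousAt.comp_continuousWithinAt (f := fun t => X t i) (hgrad _ hbdry) (hXc i t₀ ht₀'))
    have := hc.eventually_lt_const (u := 0) (by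
      beta_reduce; rw [hΩ.grad_eq_normal _ hbdry]; exact hneg)
    filter_upwards [this] with s hs
    simp only [hH, oneProj]
    rw [if_neg]
    rintro ⟨h1, h2⟩
    rw [hΩ.grad_eq_normal _ h1] at hs
    exact lt_asymm hs h2
  have hH0 : H t₀ = F i t₀ (X t₀) := hev.self_of_nhdsWithin ht₀'
  have hHc : ContinuousWithinAt H (Icc 0 T) t₀ :=
    (hFX t₀ ht₀').congr_of_eventuallyEq hev hH0
  have hle : 𝓝[Iic t₀] t₀ ≤ 𝓝[Icc 0 T] t₀ := by
    rw [← nhdsWithin_Icc_eq_nhdsLE ht₀.1]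
    exact nhdsWithin_mono _ (Icc_subset_Icc_right ht₀.2)
  have hHc' : ContinuousWithinAt H (Iic t₀) t₀ := hHc.mono_left hle
  have hII : IntervalIntegrable H volume 0 t₀ := by
    rw [intervalIntegrable_iff_integrableOn_Icc_of_le ht₀.1.le]
    exact hHint.mono_set (Icc_subset_Icc_right ht₀.2)
  have hmeas : StronglyMeasurableAtFilter H (𝓝[Iic t₀] t₀) volume :=
    ⟨Icc 0 T, hle self_mem_nhdsWithin, hHint.aestronglyMeasurable⟩
  have hd0 : HasDerivWithinAt (fun u => ∫ s in (0:ℝ)..u, H s) (H t₀) (Iic t₀) t₀ :=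
    intervalIntegral.integral_hasDerivWithinAt_right hII hmeas hHc'
  have hd : HasDerivWithinAt (fun u => X u i) (F i t₀ (X t₀)) (Iic t₀) t₀ := by
    rw [← hH0]
    refine (hd0.const_add (X0 i)).congr_of_eventuallyEq ?_ (hXint t₀ ht₀' i)
    filter_upwards [hle self_mem_nhdsWithin] with s hs using hXint s hs i
  have hdiff : DifferentiableAt ℝ (sgnDist Ω) (X t₀ i) :=
    (hΩ.smoothBoundary _ hbdry).differentiableAt (by norm_num)
  have hD : HasDerivWithinAt (fun u => sgnDist Ω (X u i))
      (⟪ν (X t₀ i), F i t₀ (X t₀)⟫) (Iic t₀) t₀ := by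
    have h := hdiff.hasGradientAt.hasFDerivAt.comp_hasDerivWithinAt t₀ hd
    rw [hΩ.grad_eq_normal _ hbdry] at h
    simpa [Function.comp_def] using h
  rw [real_inner_comm] at hneg
  have hz : sgnDist Ω (X t₀ i) = 0 := by
    simp [sgnDist, Metric.infDist_zero_of_mem hbdry]
  have hslope := hasDerivWithinAt_iff_tendsto_slope.1 hD
  have e1 := hslope.eventually_lt_const hneg
  have hset : Iic t₀ \ {t₀} = Iio t₀ := Iic_sdiff_right
  rw [hset] at e1
  have e2 : ∀ᶠ s in 𝓝[<] t₀, s ∈ Icc 0 T :=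
    (hle.trans' (nhdsWithin_mono _ Iio_subset_Iic_self)) self_mem_nhdsWithin
  obtain ⟨s, hs1, hs2, hs3⟩ := (e1.and (e2.and self_mem_nhdsWithin)).exists
  have hs3' : s < t₀ := hs3
  have hnp : sgnDist Ω (X s i) ≤ 0 := by
    simp [sgnDist, hXcl s hs2 i, Metric.infDist_nonneg]
  rw [slope_def_field, hz, sub_zero] at hs1
  exact absurd hs1 (not_lt.2 (div_nonneg_of_nonpos hnp (by linarith)))
end
end

section
/- Suppose each F_i ∈ C([0,T] × G; ℝ^m) and let X = {x_i} be a mild solution of the confined particle system on [0,T]. Suppose x_i(t₀) ∈ ∂Ω for some t₀ ∈ (0,T) and some i, and that there exists δ > 0 with t₀ + δ ≤ T such that x_i(t) ∈ Ω for all t₀ < t < t₀ + δ. Then the right derivative (d⁺/dt)x_i(t₀) := lim_{τ→0⁺} (x_i(t₀+τ) − x_i(t₀))/τ exists and equals F_i(t₀, X(t₀)), and moreover F_i(t₀, X(t₀)) · ν(x_i(t₀)) = 0; i.e., particles detach from the boundary only with velocity tangent to ∂Ω. -/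
open Set MeasureTheory Filter
open scoped RealInnerProductSpace Topology NNReal ContDiff

noncomputable section

variable {m n : ℕ}

/-- The signed distance is nonpositive on the closure. -/
lemma sgnDist_nonpos_aux {m : ℕ} (Ω : Set (Pt m)) {x : Pt m} (hx : x ∈ closure Ω) :
    sgnDist Ω x ≤ 0 := by
  unfold sgnDist
  rw [if_pos hx]
  have := Metric.infDist_nonneg (x := x) (s := frontier Ω)
  linarith

/-- The signed distance vanishes on the boundary. -/
lemma sgnDist_zero_aux {m : ℕ} (Ω : Set (Pt m)) {x : Pt m} (hx : x ∈ frontier Ω) :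
    sgnDist Ω x = 0 := by
  unfold sgnDist
  rw [if_pos (frontier_subset_closure hx), Metric.infDist_zero_of_mem hx, neg_zero]

/-- **Proposition (tangential detachment).**
If `x_i(t₀) ∈ ∂Ω` and `x_i(t) ∈ Ω` for `t₀ < t < t₀ + δ`, then the right
derivative of `x_i` at `t₀` exists and equals `F_i(t₀, X(t₀))`, and
`F_i(t₀, X(t₀)) · ν(x_i(t₀)) = 0`. -/
theorem mildSol_tangential_detachment {m n : ℕ} (Ω : Set (Pt m)) (ν : Pt m → Pt m)
    (hΩ : IsC2Domain Ω ν) (T : ℝ) (hT : 0 < T)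
    (F : Fin n → ℝ → Conf m n → Pt m)
    (hF : ∀ i, ContinuousOn (fun p : ℝ × Conf m n => F i p.1 p.2)
      (Icc 0 T ×ˢ Gset Ω n))
    (X0 : Conf m n) (X : ℝ → Conf m n) (hX : IsMildSol Ω ν F T X0 X)
    (i : Fin n) (t₀ : ℝ) (ht₀ : t₀ ∈ Ioo (0:ℝ) T)
    (hbdry : X t₀ i ∈ frontier Ω)
    (δ : ℝ) (hδ : 0 < δ) (hδT : t₀ + δ ≤ T)
    (hdetach : ∀ t ∈ Ioo t₀ (t₀ + δ), X t i ∈ Ω) :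
    HasDerivWithinAt (fun s => X s i) (F i t₀ (X t₀)) (Ici t₀) t₀ ∧
    ⟪F i t₀ (X t₀), ν (X t₀ i)⟫ = 0 := by
  obtain ⟨hXc, hXcl, hXint⟩ := hX
  have ht0I : t₀ ∈ Icc (0:ℝ) T := Ioo_subset_Icc_self ht₀
  set H : ℝ → Pt m := fun s => oneProj Ω ν (X s i) (F i s (X s)) with hH
  -- the force along the trajectory, extended continuously to the line
  have hgc : ContinuousOn (fun s => F i s (X s)) (Icc 0 T) := by
    have h1 : ContinuousOn (fun s => (s, X s)) (Icc 0 T) :=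
      continuousOn_id.prodMk (continuousOn_pi.2 hXc)
    exact (hF i).comp h1 (fun s hs => ⟨hs, hXcl s hs⟩)
  obtain ⟨g, hg, hgeq⟩ : ∃ g : ℝ → Pt m, Continuous g ∧ ∀ s ∈ Icc (0:ℝ) T, g s = F i s (X s) := by
    refine ⟨Set.IccExtend hT.le ((Icc 0 T).domRestrict (fun s => F i s (X s))), ?_, ?_⟩
    · exact (continuousOn_iff_continuous_domRestrict.1 hgc).Icc_extend'
    · intro s hs
      rw [Set.IccExtend_of_mem _ _ hs]
      rfl
  have hΩH : ∀ s ∈ Ioo t₀ (t₀ + δ), H s = g s := by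
    intro s hs
    have h1 : X s i ∉ frontier Ω := fun h =>
      (hΩ.isOpen.frontier_eq ▸ h : X s i ∈ closure Ω \ Ω).2 (hdetach s hs)
    rw [hgeq s ⟨by linarith [ht₀.1, hs.1], by linarith [hs.2]⟩]
    simp only [hH, oneProj, h1, false_and, if_false]
  have hR : ∀ t ∈ Ioo t₀ (t₀ + δ), IntervalIntegrable H volume t₀ t ∧
      ∫ s in t₀..t, H s = ∫ s in t₀..t, g s := by
    intro t ht
    have heq : ∀ s ∈ uIoc t₀ t, g s = H s := by
      intro s hs
      rw [uIoc_of_le ht.1.le] at hs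
      exact (hΩH s ⟨hs.1, hs.2.trans_lt ht.2⟩).symm
    refine ⟨(hg.intervalIntegrable t₀ t).congr heq, ?_⟩
    exact intervalIntegral.integral_congr_ae (Eventually.of_forall (fun s hs => (heq s hs).symm))
  have hI0 : IntervalIntegrable H volume 0 t₀ := by
    by_contra hn
    have ht1 : t₀ + δ / 2 ∈ Ioo t₀ (t₀ + δ) := ⟨by linarith, by linarith⟩
    have hn1 : ¬ IntervalIntegrable H volume 0 (t₀ + δ / 2) := fun h =>
      hn (h.trans (hR _ ht1).1.symm)
    have e0 := hXint t₀ ht0I i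
    have e1 := hXint (t₀ + δ / 2) ⟨by linarith [ht₀.1], by linarith⟩ i
    change X t₀ i = X0 i + ∫ s in (0:ℝ)..t₀, H s at e0
    change X (t₀ + δ / 2) i = X0 i + ∫ s in (0:ℝ)..(t₀ + δ / 2), H s at e1
    rw [intervalIntegral.integral_undef hn] at e0
    rw [intervalIntegral.integral_undef hn1, ← e0] at e1
    have h2 := hdetach _ ht1
    rw [e1] at h2
    exact (hΩ.isOpen.frontier_eq ▸ hbdry : X t₀ i ∈ closure Ω \ Ω).2 h2
  have hderg : HasDerivAt (fun t => X t₀ i + ∫ s in t₀..t, g s) (F i t₀ (X t₀)) t₀ := by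
    have := (hg.integral_hasStrictDerivAt t₀ t₀).hasDerivAt
    rw [hgeq t₀ ht0I] at this
    exact this.const_add _
  have hstep : ∀ t ∈ Icc (0:ℝ) T, IntervalIntegrable H volume t₀ t →
      X t i = X t₀ i + ∫ s in t₀..t, H s := by
    intro t ht hi
    have e0 := hXint t₀ ht0I i
    have e1 := hXint t ht i
    change X t₀ i = X0 i + ∫ s in (0:ℝ)..t₀, H s at e0
    change X t i = X0 i + ∫ s in (0:ℝ)..t, H s at e1
    rw [e1, e0, ← intervalIntegral.integral_add_adjacent_intervals hI0 hi, add_assoc]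
  have hright : HasDerivWithinAt (fun s => X s i) (F i t₀ (X t₀)) (Ici t₀) t₀ := by
    refine hderg.hasDerivWithinAt.congr_of_eventuallyEq ?_ (by simp)
    have : Ico t₀ (t₀ + δ) ∈ 𝓝[≥] t₀ := Ico_mem_nhdsGE (by linarith)
    filter_upwards [this] with t ht
    rcases eq_or_lt_of_le ht.1 with h | h
    · subst h; simp
    · have h3 := hR t ⟨h, ht.2⟩
      rw [hstep t ⟨by linarith [ht₀.1], by linarith [ht.2]⟩ h3.1, h3.2]
  refine ⟨hright, ?_⟩
  -- the signed distance along the trajectory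
  have hC2 := hΩ.smoothBoundary _ hbdry
  have hφ : HasFDerivAt (sgnDist Ω) (fderiv ℝ (sgnDist Ω) (X t₀ i)) (X t₀ i) :=
    (hC2.differentiableAt (by norm_num)).hasFDerivAt
  have hval : ∀ y v : Pt m, fderiv ℝ (sgnDist Ω) y v = ⟪v, gradient (sgnDist Ω) y⟫ := by
    intro y v
    rw [real_inner_comm]
    simp [gradient]
  have hφ0 : sgnDist Ω (X t₀ i) = 0 := sgnDist_zero_aux Ω hbdry
  have hle : ⟪F i t₀ (X t₀), ν (X t₀ i)⟫ ≤ 0 := by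
    have hd := hφ.comp_hasDerivWithinAt t₀ hright
    rw [hval, hΩ.grad_eq_normal _ hbdry] at hd
    have hd2 := hasDerivWithinAt_iff_tendsto_slope.1 hd
    rw [Ici_sdiff_left] at hd2
    refine le_of_tendsto hd2 ?_
    filter_upwards [Ioo_mem_nhdsGT (show t₀ < t₀ + δ by linarith)] with t ht
    rw [slope_def_field]
    simp only [Function.comp, hφ0]
    exact div_nonpos_of_nonpos_of_nonneg
      (by linarith [sgnDist_nonpos_aux Ω (subset_closure (hdetach t ht))]) (by linarith [ht.1])
  refine le_antisymm hle ?_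
  by_contra hneg
  push Not at hneg
  -- near t₀, the projection is inactive
  have hcont : ContinuousAt (fderiv ℝ (sgnDist Ω)) (X t₀ i) :=
    (hC2.fderiv_right (m := 1) (by norm_num)).continuousAt
  have hXat : ContinuousAt (fun t => X t i) t₀ :=
    (hXc i).continuousAt (Icc_mem_nhds ht₀.1 ht₀.2)
  have hc2 : ContinuousAt (fun s => fderiv ℝ (sgnDist Ω) (X s i) (g s)) t₀ :=
    (ContinuousAt.comp (f := fun t => X t i) hcont hXat).clm_apply hg.continuousAt
  have hlt : ∀ᶠ s in 𝓝 t₀, fderiv ℝ (sgnDist Ω) (X s i) (g s) < 0 := by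
    apply hc2.eventually_lt_const
    beta_reduce
    rw [hval, hΩ.grad_eq_normal _ hbdry, hgeq t₀ ht0I]
    exact hneg
  have hev : ∀ᶠ s in 𝓝 t₀, s ∈ Icc (0:ℝ) T ∧ H s = g s := by
    filter_upwards [hlt, Icc_mem_nhds ht₀.1 ht₀.2] with s hs hsI
    refine ⟨hsI, ?_⟩
    simp only [hH, oneProj]
    rw [hgeq s hsI] at hs ⊢
    rw [if_neg]
    rintro ⟨h1, h2⟩
    rw [hval, hΩ.grad_eq_normal _ h1] at hs
    linarith
  obtain ⟨ε, hε, hball⟩ := Metric.eventually_nhds_iff.1 hev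
  have hleft : HasDerivWithinAt (fun s => X s i) (F i t₀ (X t₀)) (Iic t₀) t₀ := by
    refine hderg.hasDerivWithinAt.congr_of_eventuallyEq ?_ (by simp)
    have : Ioc (t₀ - ε) t₀ ∈ 𝓝[≤] t₀ := Ioc_mem_nhdsLE (by linarith)
    filter_upwards [this] with t ht
    have heq : ∀ s ∈ uIoc t₀ t, g s = H s := by
      intro s hs
      rw [uIoc_of_ge ht.2] at hs
      refine (hball ?_).2.symm
      rw [Real.dist_eq, abs_lt]
      constructor <;> linarith [hs.1, hs.2, ht.1, ht.2]
    have htI : t ∈ Icc (0:ℝ) T := by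
      refine (hball ?_).1
      rw [Real.dist_eq, abs_lt]
      constructor <;> linarith [ht.1, ht.2]
    rw [hstep t htI ((hg.intervalIntegrable t₀ t).congr heq),
      intervalIntegral.integral_congr_ae (Eventually.of_forall (fun s hs => (heq s hs).symm))]
  have hd := hφ.comp_hasDerivWithinAt t₀ hleft
  rw [hval, hΩ.grad_eq_normal _ hbdry] at hd
  have hd2 := hasDerivWithinAt_iff_tendsto_slope.1 hd
  rw [Iic_sdiff_right] at hd2
  refine absurd (ge_of_tendsto hd2 (b := 0) ?_) (not_le.2 hneg)
  filter_upwards [Ioo_mem_nhdsLT ht₀.1] with t ht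
  rw [slope_def_field]
  simp only [Function.comp, hφ0]
  exact div_nonneg_of_nonpos
    (by linarith [sgnDist_nonpos_aux Ω (hXcl t ⟨ht.1.le, by linarith [ht.2, ht₀.2]⟩ i)])
    (by linarith [ht.2])
end
end

section
/- The particle interaction energy E attains its minimum on G_*: there exists X̄ ∈ G_* such that E(X̄) ≤ E(X) for all X ∈ G_*. -/
open Set MeasureTheory Filter
open scoped RealInnerProductSpace Topology NNReal ContDiff

noncomputable section

variable {m n : ℕ}

lemma pair_le_energy {m n : ℕ} (hn : 2 ≤ n) (Ω : Set (Pt m)) (V W : Pt m → ℝ)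
    (hVsym : ∀ x : Pt m, x ≠ 0 → V (-x) = V x)
    (hVpos : ∀ x : Pt m, x ≠ 0 → 0 < V x)
    (hW0 : ∀ x ∈ closure Ω, 0 ≤ W x) (X : Conf m n) (hX : X ∈ Gstar Ω n)
    (i j : Fin n) (hij : i ≠ j) :
    V (X i - X j) ≤ ((n : ℝ) * ((n : ℝ) - 1)) * energy V W X := by
  have hn' : (2 : ℝ) ≤ n := by exact_mod_cast hn
  have hc : 0 < (n : ℝ) * ((n : ℝ) - 1) := by
    apply mul_pos <;> linarith
  have key : ∀ i j : Fin n, j < i → V (X i - X j) ≤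
      ∑ i : Fin n, ∑ j ∈ Finset.filter (fun j => j < i) Finset.univ, V (X i - X j) := by
    intro i j hlt
    have hnn : ∀ a : Fin n, ∀ b ∈ Finset.filter (fun b => b < a) Finset.univ,
        0 ≤ V (X a - X b) := by
      intro a b hb
      have hba : b < a := by simpa using hb
      exact (hVpos _ (sub_ne_zero.mpr (hX.2 a b hba.ne'))).le
    calc V (X i - X j) ≤ ∑ j ∈ Finset.filter (fun j => j < i) Finset.univ, V (X i - X j) :=
          Finset.single_le_sum (f := fun j => V (X i - X j)) (hnn i) (by simpa using hlt)
      _ ≤ _ := Finset.single_le_sum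
          (f := fun i => ∑ j ∈ Finset.filter (fun j => j < i) Finset.univ, V (X i - X j))
          (fun a _ => Finset.sum_nonneg (hnn a)) (Finset.mem_univ i)
  have hWn : 0 ≤ (n : ℝ) * ((n : ℝ) - 1) * ((1 / (n : ℝ)) * ∑ i : Fin n, W (X i)) :=
    mul_nonneg hc.le (mul_nonneg (by positivity)
      (Finset.sum_nonneg fun i _ => hW0 _ (hX.1 i)))
  have hE : ∑ i : Fin n, ∑ j ∈ Finset.filter (fun j => j < i) Finset.univ, V (X i - X j)
      ≤ ((n : ℝ) * ((n : ℝ) - 1)) * energy V W X := by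
    unfold energy
    rw [mul_add, ← mul_assoc, mul_one_div_cancel hc.ne', one_mul]
    linarith
  rcases lt_or_gt_of_ne hij with h | h
  · have h1 := hVsym _ (sub_ne_zero.mpr (hX.2 i j hij))
    rw [neg_sub] at h1
    rw [← h1]
    exact (key j i h).trans hE
  · exact (key i j h).trans hE

lemma Gstar_nonempty {m n : ℕ} (hm : 0 < m) (Ω : Set (Pt m)) (hΩo : IsOpen Ω)
    (hΩne : Ω.Nonempty) : (Gstar Ω n).Nonempty := by
  obtain ⟨x, hx⟩ := hΩne
  haveI : Nonempty (Fin m) := ⟨⟨0, hm⟩⟩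
  haveI : Nontrivial (Pt m) := inferInstance
  haveI : (𝓝[≠] x).NeBot := Module.punctured_nhds_neBot ℝ (Pt m) x
  have hinf : Ω.Infinite := infinite_of_mem_nhds x (hΩo.mem_nhds hx)
  refine ⟨fun i => (hinf.natEmbedding Ω i : Pt m), fun i => subset_closure (Subtype.coe_prop _), ?_⟩
  intro i j hij h
  exact hij (Fin.ext ((hinf.natEmbedding Ω).injective (Subtype.ext h)))

/-- **Existence of minimizers of the interaction energy on `G_*`.** -/
theorem energy_min_exists {m n : ℕ} (hm : 0 < m) (hn : 2 ≤ n)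
    (Ω : Set (Pt m)) (hΩo : IsOpen Ω) (hΩne : Ω.Nonempty)
    (hΩb : Bornology.IsBounded Ω)
    (V : Pt m → ℝ) (hV : ContDiffOn ℝ 2 V {(0:Pt m)}ᶜ)
    (hVtop : Tendsto V (𝓝[≠] (0:Pt m)) atTop)
    (hVsym : ∀ x : Pt m, x ≠ 0 → V (-x) = V x)
    (hVpos : ∀ x : Pt m, x ≠ 0 → 0 < V x)
    (W : Pt m → ℝ) (hW : ∀ x ∈ closure Ω, ContDiffAt ℝ 2 W x)
    (hW0 : ∀ x ∈ closure Ω, 0 ≤ W x) :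
    ∃ Xb ∈ Gstar Ω n, ∀ X ∈ Gstar Ω n, energy V W Xb ≤ energy V W X := by
  have hn' : (2 : ℝ) ≤ n := by exact_mod_cast hn
  have hc : 0 < (n : ℝ) * ((n : ℝ) - 1) := by
    apply mul_pos <;> linarith
  obtain ⟨X0, hX0⟩ := Gstar_nonempty (n := n) hm Ω hΩo hΩne
  have hev := hVtop.eventually_gt_atTop (((n : ℝ) * ((n : ℝ) - 1)) * energy V W X0)
  rw [eventually_nhdsWithin_iff, Metric.eventually_nhds_iff] at hev
  obtain ⟨δ, hδ, hVδ⟩ := hev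
  let K : Set (Conf m n) := {X | (∀ i, X i ∈ closure Ω) ∧ ∀ i j, i ≠ j → δ ≤ dist (X i) (X j)}
  have hKG : ∀ X ∈ K, X ∈ Gstar Ω n := fun X hX =>
    ⟨hX.1, fun i j hij => dist_pos.mp (hδ.trans_le (hX.2 i j hij))⟩
  have hout : ∀ X ∈ Gstar Ω n, energy V W X ≤ energy V W X0 → X ∈ K := by
    intro X hX hle
    refine ⟨hX.1, fun i j hij => ?_⟩
    by_contra hlt
    push Not at hlt
    have h1 := @hVδ (X i - X j) (by simpa [dist_eq_norm] using hlt)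
      (sub_ne_zero.mpr (hX.2 i j hij))
    have h2 := pair_le_energy hn Ω V W hVsym hVpos hW0 X hX i j hij
    have h3 := mul_le_mul_of_nonneg_left hle hc.le
    linarith
  have hKc : IsCompact K := by
    have hcl : IsCompact (closure Ω) := hΩb.isCompact_closure
    have hG : IsCompact (Set.univ.pi fun _ : Fin n => closure Ω) :=
      isCompact_univ_pi fun _ => hcl
    have hcl2 : IsClosed {X : Conf m n | ∀ i j, i ≠ j → δ ≤ dist (X i) (X j)} := by
      simp only [Set.setOf_forall]
      refine isClosed_iInter fun i => isClosed_iInter fun j => isClosed_iInter fun _ => ?_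
      exact isClosed_le continuous_const (by fun_prop)
    have : K = (Set.univ.pi fun _ : Fin n => closure Ω) ∩
        {X : Conf m n | ∀ i j, i ≠ j → δ ≤ dist (X i) (X j)} := by
      ext X; simp [K]
    rw [this]
    exact hG.inter_right hcl2
  have hcont : ContinuousOn (fun X : Conf m n => energy V W X) K := by
    unfold energy
    refine ContinuousOn.add (continuousOn_const.mul ?_) (continuousOn_const.mul ?_)
    · refine continuousOn_finsetSum _ fun i _ => continuousOn_finsetSum _ fun j hj => ?_
      have hji : j < i := by simpa using hj
      refine hV.continuousOn.comp (f := fun X : Conf m n => X i - X j)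
        (Continuous.continuousOn (by fun_prop)) ?_
      intro X hX
      exact sub_ne_zero.mpr ((hKG X hX).2 i j hji.ne')
    · refine continuousOn_finsetSum _ fun i _ => ?_
      have hWc : ContinuousOn W (closure Ω) := fun x hx =>
        (hW x hx).continuousAt.continuousWithinAt
      exact hWc.comp (f := fun X : Conf m n => X i)
        (Continuous.continuousOn (by fun_prop)) fun X hX => hX.1 i
  have hX0K := hout X0 hX0 le_rfl
  obtain ⟨Xb, hXb, hmin⟩ := hKc.exists_isMinOn ⟨X0, hX0K⟩ hcont
  refine ⟨Xb, hKG Xb hXb, fun X hX => ?_⟩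
  by_cases h : energy V W X ≤ energy V W X0
  · exact hmin (hout X hX h)
  · exact (hmin hX0K).trans (not_le.mp h).le
end
end
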